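/- arXiv:2003.06624 — 7 statements merged into one kernel-verified Lean document; each statement's English description precedes it below -/
import Mathlib

section
/- Let G be a finite group which is a 5-BCI-group or a 6-BCI-group. Then every Sylow 2-subgroup of G is elementary abelian, cyclic, or generalized quaternion. -/
open SimpleGraph

/-- The bi-Cayley graph `BCay(G,S)`: vertex set `G × {1,2}` (encoded as `G × Fin 2`,
where index `0` stands for part `1` and index `1` for part `2`), with edges
`{(g,1),(sg,2)}` for `g ∈ G`, `s ∈ S`. -/
def BCay (G : Type*) [Group G] (S : Set G) : SimpleGraph (G × Fin 2) :=
  SimpleGraph.fromRel (fun u v => u.2 = 0 ∧ v.2 = 1 ∧ v.1 * u.1⁻¹ ∈ S)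

/-- `BCay(G,S)` is a BCI-graph. -/
def IsBCIGraph (G : Type*) [Group G] (S : Set G) : Prop :=
  ∀ T : Set G, Nonempty (BCay G S ≃g BCay G T) →
    ∃ (g : G) (α : G ≃* G), T = (fun s => g * α s) '' S

/-- `G` is a BCI-group. -/
def IsBCIGroup (G : Type*) [Group G] : Prop :=
  ∀ S : Set G, IsBCIGraph G S

/-- `G` is an `m`-BCI-group. -/
def IsmBCIGroup (G : Type*) [Group G] (m : ℕ) : Prop :=
  ∀ S : Set G, S.ncard ≤ m → IsBCIGraph G S

/-- The Cayley graph `Cay(G,S)`, for `1 ∉ S = S⁻¹`. -/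
def Cay (G : Type*) [Group G] (S : Set G) : SimpleGraph G :=
  SimpleGraph.fromRel (fun x y => y * x⁻¹ ∈ S)

/-- `Cay(G,S)` is a CI-graph. -/
def IsCIGraph (G : Type*) [Group G] (S : Set G) : Prop :=
  ∀ T : Set G, 1 ∉ T → T⁻¹ = T → Nonempty (Cay G S ≃g Cay G T) →
    ∃ α : G ≃* G, T = α '' S

/-- `G` is a CI-group. -/
def IsCIGroup (G : Type*) [Group G] : Prop :=
  ∀ S : Set G, 1 ∉ S → S⁻¹ = S → IsCIGraph G S

/-- `G` is an `m`-CI-group. -/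
def IsmCIGroup (G : Type*) [Group G] (m : ℕ) : Prop :=
  ∀ S : Set G, 1 ∉ S → S⁻¹ = S → S.ncard ≤ m → IsCIGraph G S

/-- Left multiplication by the image of `A` on a transversal of its right cosets identifies
`A × (A \ G)` with `G`. -/
theorem bijective_mul_out {G A : Type*} [Group G] [Group A] (i : A →* G)
    (hi : Function.Injective i) :
    Function.Bijective (fun p : A × Quotient (QuotientGroup.rightRel i.range) =>
      i p.1 * p.2.out) := by
  have key : ∀ (a : A) (q : Quotient (QuotientGroup.rightRel i.range)),
      Quotient.mk _ (i a * q.out) = q := by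
    intro a q
    conv_rhs => rw [← q.out_eq]
    apply Quotient.sound
    change (QuotientGroup.rightRel i.range) _ _
    rw [QuotientGroup.rightRel_apply]
    exact ⟨a⁻¹, by simp⟩
  refine ⟨?_, fun g => ?_⟩
  · rintro ⟨a, q⟩ ⟨b, r⟩ h
    have hqr : q = r := by
      rw [← key a q, ← key b r]
      exact congrArg _ h
    subst hqr
    simpa using hi (mul_right_cancel h)
  · have h : (QuotientGroup.rightRel i.range) g
        (Quotient.mk (QuotientGroup.rightRel i.range) g).out :=
      (QuotientGroup.rightRel i.range).symm (Quotient.mk_out (s := QuotientGroup.rightRel _) g)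
    rw [QuotientGroup.rightRel_apply] at h
    obtain ⟨a, ha⟩ := h
    exact ⟨(a⁻¹, Quotient.mk _ g), by simp [ha]⟩

/-- Differences in the coordinates provided by `bijective_mul_out`. -/
theorem mul_out_div_mem_image_iff {G A : Type*} [Group G] [Group A] (i : A →* G)
    (hi : Function.Injective i) (U : Set A) (p q : A × Quotient (QuotientGroup.rightRel i.range)) :
    (i q.1 * q.2.out) * (i p.1 * p.2.out)⁻¹ ∈ i '' U ↔ p.2 = q.2 ∧ q.1 * p.1⁻¹ ∈ U := by
  rcases p with ⟨a, p⟩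
  rcases q with ⟨b, q⟩
  constructor
  · rintro ⟨u, hu, h⟩
    have h2 := @(bijective_mul_out i hi).1 (u * a, p) (b, q) (by
      simp only [map_mul, h]; group)
    simp only [Prod.mk.injEq] at h2
    obtain ⟨h2, rfl⟩ := h2
    refine ⟨rfl, ?_⟩
    rw [← h2]
    simpa using hu
  · rintro ⟨h, hU⟩
    dsimp only at h
    subst h
    exact ⟨_, hU, by simp [mul_assoc]⟩

theorem BCay_adj_iff {G : Type*} [Group G] (S : Set G) (u v : G × Fin 2) :
    (BCay G S).Adj u v ↔
      (u.2 = 0 ∧ v.2 = 1 ∧ v.1 * u.1⁻¹ ∈ S) ∨ (v.2 = 0 ∧ u.2 = 1 ∧ u.1 * v.1⁻¹ ∈ S) := by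
  simp only [BCay, SimpleGraph.fromRel_adj, and_iff_right_iff_imp]
  rintro (⟨h0, h1, -⟩ | ⟨h0, h1, -⟩) rfl <;> simp [h0] at h1

/-- A permutation of `G` compatible with difference sets induces an isomorphism of
bi-Cayley graphs. -/
theorem nonempty_BCay_iso_of_perm {G : Type*} [Group G] {S T : Set G} (f : G ≃ G)
    (hf : ∀ g h, h * g⁻¹ ∈ S ↔ f h * (f g)⁻¹ ∈ T) :
    Nonempty (BCay G S ≃g BCay G T) :=
  ⟨⟨f.prodCongr (Equiv.refl _), by
    intro u v
    simp [BCay_adj_iff, hf]⟩⟩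

/-- Isomorphic bi-Cayley graphs on embedded groups of equal order give isomorphic bi-Cayley
graphs on the ambient group. -/
theorem nonempty_BCay_iso_of_embeddings {G A B : Type*} [Group G] [Finite G] [Group A] [Group B]
    (i : A →* G) (hi : Function.Injective i) (j : B →* G) (hj : Function.Injective j)
    (φ : A ≃ B) (S : Set A) (T : Set B)
    (hφ : ∀ a b, b * a⁻¹ ∈ S ↔ φ b * (φ a)⁻¹ ∈ T) :
    Nonempty (BCay G (i '' S) ≃g BCay G (j '' T)) := by
  let e := Equiv.ofBijective _ (bijective_mul_out i hi)
  let e' := Equiv.ofBijective _ (bijective_mul_out j hj)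
  have : Finite A := Finite.of_injective i hi
  have hcard : Nat.card (Quotient (QuotientGroup.rightRel i.range)) =
      Nat.card (Quotient (QuotientGroup.rightRel j.range)) := by
    have h := (Nat.card_congr e).trans (Nat.card_congr e').symm
    rw [Nat.card_prod, Nat.card_prod, ← Nat.card_congr φ] at h
    exact Nat.eq_of_mul_eq_mul_left Nat.card_pos h
  have : Finite (Quotient (QuotientGroup.rightRel i.range)) := Quotient.finite _
  have : Finite (Quotient (QuotientGroup.rightRel j.range)) := Quotient.finite _
  obtain ⟨θ⟩ := (Finite.card_eq).1 hcard
  refine nonempty_BCay_iso_of_perm ((e.symm.trans (φ.prodCongr θ)).trans e') ?_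
  intro g h
  obtain ⟨p, rfl⟩ := e.surjective g
  obtain ⟨q, rfl⟩ := e.surjective h
  simp only [Equiv.trans_apply, Equiv.symm_apply_apply]
  refine (mul_out_div_mem_image_iff i hi S p q).trans (Iff.trans ?_
    (mul_out_div_mem_image_iff j hj T (φ.prodCongr θ p) (φ.prodCongr θ q)).symm)
  simp [hφ]

/-- The Klein four-group generated by two commuting involutions. -/
def kleinFour {G : Type*} [Group G] (u v : G) (hu : u * u = 1) (hv : v * v = 1)
    (huv : u * v = v * u) : Subgroup G where
  carrier := {1, u, v, u * v}
  one_mem' := by simp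
  mul_mem' := by
    have h2 : v * (u * v) = u := by rw [huv, ← mul_assoc, hv, one_mul]
    have h3 : u * (u * v) = v := by rw [← mul_assoc, hu, one_mul]
    rintro a b (rfl | rfl | rfl | rfl) (rfl | rfl | rfl | rfl) <;>
      simp [hu, hv, h2, h3, mul_assoc, huv.symm]
  inv_mem' := by
    have hu' : u⁻¹ = u := inv_eq_of_mul_eq_one_left hu
    have hv' : v⁻¹ = v := inv_eq_of_mul_eq_one_left hv
    rintro a (rfl | rfl | rfl | rfl) <;> simp [hu', hv', huv]

theorem card_kleinFour {G : Type*} [Group G] {u v : G} (hu : u * u = 1) (hv : v * v = 1)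
    (huv : u * v = v * u) (hu1 : u ≠ 1) (hv1 : v ≠ 1) (hne : u ≠ v) :
    Nat.card (kleinFour u v hu hv huv) = 4 := by
  have h1 : u * v ≠ 1 := fun h => hne (mul_right_cancel (h.trans hv.symm))
  change Nat.card ({1, u, v, u * v} : Set G) = 4
  classical
  rw [show ({1, u, v, u * v} : Set G) = (({1, u, v, u * v} : Finset G) : Set G) by simp]
  rw [Nat.card_coe_set_eq, Set.ncard_coe_finset]
  have h2 : u ≠ u * v := fun h => hv1 (by simpa using h.symm)
  have h3 : v ≠ u * v := fun h => hu1 (by simpa using h.symm)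
  simp [hu1.symm, hv1.symm, h1.symm, hne, h2, h3]

theorem pow_two_of_mem_kleinFour {G : Type*} [Group G] {u v : G} (hu : u * u = 1)
    (hv : v * v = 1) (huv : u * v = v * u) {w : G} (hw : w ∈ kleinFour u v hu hv huv) :
    w * w = 1 := by
  rcases hw with rfl | rfl | rfl | rfl
  · simp
  · exact hu
  · exact hv
  · rw [mul_assoc, ← mul_assoc v, ← huv, mul_assoc, hv, mul_one, hu]

/-- A 3-BCI-group with an element of order 4 has no Klein four-subgroup. -/
theorem IsmBCIGroup.eq_of_commute_involutions {G : Type*} [Group G] [Finite G]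
    (h : IsmBCIGroup G 3) {x : G} (hx : orderOf x = 4) {u v : G} (hu : u * u = 1)
    (hv : v * v = 1) (huv : u * v = v * u) (hu1 : u ≠ 1) (hv1 : v ≠ 1) : u = v := by
  by_contra hne
  let H := Subgroup.zpowers x
  let K := kleinFour u v hu hv huv
  have hH : Nat.card H = 4 := by rw [Nat.card_zpowers, hx]
  have hK : Nat.card K = 4 := card_kleinFour hu hv huv hu1 hv1 hne
  obtain ⟨φ⟩ : Nonempty (H ≃ K) := Finite.card_eq.1 (hH.trans hK.symm)
  have hiso := nonempty_BCay_iso_of_embeddings H.subtype H.subtype_injective K.subtype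
    K.subtype_injective φ {1}ᶜ {1}ᶜ (by simp [mul_inv_eq_one])
  have hcard : (H.subtype '' {1}ᶜ).ncard ≤ 3 := by
    rw [Set.ncard_image_of_injective _ H.subtype_injective, Set.ncard_compl, hH]
    simp
  obtain ⟨g, α, hα⟩ := h _ hcard _ hiso
  have hx1 : x ≠ 1 := by rintro rfl; simp at hx
  have hx2 : x ^ 2 ≠ 1 := fun h => by
    have := orderOf_dvd_of_pow_eq_one h
    rw [hx] at this; norm_num at this
  have hmem : ∀ y ∈ H, y ≠ 1 → g * α y ∈ K := by
    intro y hy hy1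
    have : g * α y ∈ K.subtype '' {1}ᶜ := hα ▸ ⟨y, ⟨⟨y, hy⟩, by simpa using hy1, rfl⟩, rfl⟩
    obtain ⟨k, -, hk⟩ := this
    exact hk ▸ k.2
  have h1 := hmem x (Subgroup.mem_zpowers x) hx1
  have h2 := hmem (x ^ 2) (Subgroup.npow_mem_zpowers x 2) hx2
  have h3 := pow_two_of_mem_kleinFour hu hv huv (K.mul_mem (K.inv_mem h1) h2)
  apply hx2
  apply α.injective
  have h4 : (g * α x)⁻¹ * (g * α (x ^ 2)) = α x := by
    rw [sq, map_mul]
    group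
  rw [map_one, map_pow, sq, ← h4, h3]

/-- The homomorphism from the cyclic group of order `n` sending the generator to `x`. -/
def powZMod {G : Type*} [Group G] (x : G) {n : ℕ} (hx : x ^ n = 1) :
    Multiplicative (ZMod n) →* G :=
  AddMonoidHom.toMultiplicativeLeft
    (ZMod.lift n ⟨zmultiplesHom _ (Additive.ofMul x), by
      simp [← ofMul_pow, hx]⟩)

theorem powZMod_intCast {G : Type*} [Group G] (x : G) {n : ℕ} (hx : x ^ n = 1) (k : ℤ) :
    powZMod x hx (.ofAdd (k : ZMod n)) = x ^ k := by
  simp [powZMod]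

theorem powZMod_injective {G : Type*} [Group G] (x : G) {n : ℕ} (hn : orderOf x = n) :
    Function.Injective (powZMod x (hn ▸ pow_orderOf_eq_one x)) := by
  rw [injective_iff_map_eq_one]
  intro a ha
  obtain ⟨k, hk⟩ := ZMod.intCast_surjective a.toAdd
  rw [← ofAdd_toAdd a, ← hk, powZMod_intCast, ← orderOf_dvd_iff_zpow_eq_one, hn] at ha
  rw [← ofAdd_toAdd a, ← hk, (ZMod.intCast_zmod_eq_zero_iff_dvd k n).2 ha]
  rfl

/-- The permutation of `ZMod 8` shifting the odd residues by `2`. -/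
def oddShift : ZMod 8 ≃ ZMod 8 where
  toFun a := if a.val % 2 = 0 then a else a + 2
  invFun a := if a.val % 2 = 0 then a else a - 2
  left_inv := by decide
  right_inv := by decide

/-- A 4-BCI-group has no element of order 8. -/
theorem IsmBCIGroup.orderOf_ne_eight {G : Type*} [Group G] [Finite G]
    (h : IsmBCIGroup G 4) (x : G) : orderOf x ≠ 8 := by
  intro hx
  have hx8 : x ^ 8 = 1 := hx ▸ pow_orderOf_eq_one x
  let i := powZMod x hx8
  have hi : Function.Injective i := powZMod_injective x hx
  let S : Finset (ZMod 8) := {0, 1, 2, 5}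
  let T : Finset (ZMod 8) := {0, 2, 3, 7}
  have hiso := nonempty_BCay_iso_of_embeddings i hi i hi
    ((Multiplicative.toAdd.trans oddShift).trans Multiplicative.ofAdd)
    {a | a.toAdd ∈ S} {a | a.toAdd ∈ T} (by
      have : ∀ a b : ZMod 8, b - a ∈ S ↔ oddShift b - oddShift a ∈ T := by decide
      intro a b
      simpa [← sub_eq_add_neg] using this a.toAdd b.toAdd)
  have hcard : (i '' {a | a.toAdd ∈ S}).ncard ≤ 4 := by
    rw [Set.ncard_image_of_injective _ hi]
    exact (Set.ncard_coe_finset S).le.trans (by decide)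
  obtain ⟨g, α, hα⟩ := h _ hcard _ hiso
  have hmem : ∀ s ∈ S, ∃ t ∈ T, i (.ofAdd t) = g * α (i (.ofAdd s)) := by
    intro s hs
    have : g * α (i (.ofAdd s)) ∈ i '' {a | a.toAdd ∈ T} := hα ▸ ⟨_, ⟨_, hs, rfl⟩, rfl⟩
    obtain ⟨t, ht, h⟩ := this
    exact ⟨t.toAdd, ht, h⟩
  obtain ⟨a, -, ha⟩ := hmem 0 (by decide)
  obtain ⟨b, -, hb⟩ := hmem 1 (by decide)
  have hg : g = i (.ofAdd a) := by simpa using ha.symm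
  have hαx : α (i (.ofAdd 1)) = i (.ofAdd (b - a)) := by
    have hab : a + (b - a) = b := by ring
    rw [← hab, ofAdd_add, map_mul, hg] at hb
    exact (mul_left_cancel hb).symm
  have hc : 4 * (b - a) ≠ 0 := fun h0 => by
    have h1 : α (i (.ofAdd 1) ^ 4) = α 1 := by
      rw [map_pow, hαx, ← map_pow, ← ofAdd_nsmul, nsmul_eq_mul]
      simp [h0]
    rw [α.injective.eq_iff, ← map_pow, ← ofAdd_nsmul, ← map_one i] at h1
    exact absurd (hi h1) (by decide)
  have hmem' : ∀ s ∈ S, a + s.val * (b - a) ∈ T := by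
    intro s hs
    obtain ⟨t, ht, h⟩ := hmem s hs
    have hs' : i (.ofAdd s) = i (.ofAdd 1) ^ s.val := by
      rw [← map_pow, ← ofAdd_nsmul]
      simp
    rw [hs', map_pow, hαx, hg, ← map_pow, ← map_mul, ← ofAdd_nsmul, ← ofAdd_add] at h
    have := hi h
    rw [Multiplicative.ofAdd.injective.eq_iff, nsmul_eq_mul] at this
    exact this ▸ ht
  have hno : ∀ a c : ZMod 8, 4 * c ≠ 0 → ¬ ∀ s ∈ S, a + s.val * c ∈ T := by decide
  exact hno a (b - a) hc hmem'

/-- A group of exponent dividing 4 in which any two commuting involutions coincide is cyclic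
or quaternion of order 8, unless it has exponent 2. -/
theorem isCyclic_or_quaternion {P : Type*} [Group P] (h4 : ∀ w : P, w ^ 4 = 1)
    (hcomm : ∀ u v : P, u * u = 1 → v * v = 1 → u * v = v * u → u ≠ 1 → v ≠ 1 → u = v)
    {x : P} (hx : x ^ 2 ≠ 1) :
    IsCyclic P ∨ Nonempty (P ≃* QuaternionGroup 2) := by
  have hx4 : orderOf x = 2 * 2 := by
    have := orderOf_eq_prime_pow (p := 2) (n := 1) (x := x) (by simpa using hx)
      (by simpa using h4 x)
    simpa using this
  have hinv : ∀ u v : P, u * u = 1 → v * v = 1 → u ≠ 1 → v ≠ 1 → u = v := by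
    intro u v hu hv hu1 hv1
    by_contra hne
    have hu' : u⁻¹ = u := inv_eq_of_mul_eq_one_left hu
    have hv' : v⁻¹ = v := inv_eq_of_mul_eq_one_left hv
    set t := (u * v) * (u * v) with ht
    have htt : t * t = 1 := by
      have := h4 (u * v)
      rw [← this, ht]
      simp only [pow_succ, pow_zero, one_mul, mul_assoc]
    have ht1 : t ≠ 1 := fun h => by
      refine hne (hcomm u v hu hv ?_ hu1 hv1)
      rw [ht, mul_eq_one_iff_eq_inv, mul_inv_rev, hu', hv'] at h
      exact h
    have htinv : t⁻¹ = t := inv_eq_of_mul_eq_one_left htt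
    have htu : t * u = u * t := by
      conv_rhs => rw [← htinv, ht]
      simp only [mul_inv_rev, hu', hv', ht, ← mul_assoc]
    have htv : t * v = v * t := by
      conv_lhs => rw [← htinv, ht]
      simp only [mul_inv_rev, hu', hv', ht, mul_assoc]
    exact hne ((hcomm t u htt hu htu ht1 hu1).symm.trans (hcomm t v htt hv htv ht1 hv1))
  have hxx : x ^ 2 * x ^ 2 = 1 := by rw [← pow_add, h4]
  have hsq : ∀ w : P, w ^ 2 ≠ 1 → w ^ 2 = x ^ 2 := by
    intro w hw
    exact hinv _ _ (by rw [← pow_add, h4]) hxx hw hx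
  have hcent : ∀ w : P, w * x = x * w → w ∈ Subgroup.zpowers x := by
    intro w hw
    by_cases hw2 : w ^ 2 = 1
    · by_cases hw1 : w = 1
      · exact hw1 ▸ one_mem _
      · have := hinv w (x ^ 2) (by rw [← sq, hw2]) hxx hw1 hx
        exact this ▸ Subgroup.npow_mem_zpowers x 2
    · have h1 : (w * x) ^ 2 = 1 := by
        rw [(show Commute w x from hw).mul_pow, hsq w hw2, hxx]
      by_cases hw1 : w * x = 1
      · rw [eq_inv_of_mul_eq_one_left hw1]
        exact inv_mem (Subgroup.mem_zpowers x)
      · have := hinv (w * x) (x ^ 2) (by rw [← sq, h1]) hxx hw1 hx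
        rw [sq, mul_left_inj] at this
        exact this ▸ Subgroup.mem_zpowers x
  have hsq' : ∀ w : P, w ∉ Subgroup.zpowers x → w ^ 2 = x ^ 2 := fun w hw =>
      hsq w fun h => hw <| by
    by_cases hw1 : w = 1
    · exact hw1 ▸ one_mem _
    · have := hinv w (x ^ 2) (by rw [← sq, h]) hxx hw1 hx
      exact this ▸ Subgroup.npow_mem_zpowers x 2
  have hconj : ∀ w : P, w ∉ Subgroup.zpowers x → x * w = w * x⁻¹ := by
    intro w hw
    have hw2 := hsq' w hw
    have hwx : (x * w) ^ 2 = x ^ 2 := hsq _ fun h => hw <| by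
      by_cases hw1 : x * w = 1
      · rw [eq_inv_of_mul_eq_one_right hw1]
        exact inv_mem (Subgroup.mem_zpowers x)
      · have := hinv (x * w) (x ^ 2) (by rw [← sq, h]) hxx hw1 hx
        rw [sq, mul_right_inj] at this
        exact this ▸ Subgroup.mem_zpowers x
    have h1 : w * (x * w) = x := by
      apply mul_left_cancel (a := x)
      rw [← mul_assoc, ← sq, hwx, sq]
    have h2 : w * w = x * x := by rw [← sq, hw2, sq]
    apply mul_left_cancel (a := w)
    rw [h1, ← mul_assoc, h2, mul_inv_cancel_right]
  by_cases htop : ∀ w, w ∈ Subgroup.zpowers x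
  · exact Or.inl ⟨x, htop⟩
  · right
    push Not at htop
    obtain ⟨y, hy⟩ := htop
    let E : ZMod (2 * 2) → P := fun k => powZMod x (hx4 ▸ pow_orderOf_eq_one x) (.ofAdd k)
    have hE : Function.Injective E :=
      (powZMod_injective x hx4).comp Multiplicative.ofAdd.injective
    have hadd : ∀ a b, E (a + b) = E a * E b := fun a b => by simp [E]
    have hzp : ∀ k : ℤ, E k = x ^ k := fun k => powZMod_intCast x _ k
    have hmem : ∀ a, E a ∈ Subgroup.zpowers x := fun a => by
      obtain ⟨k, rfl⟩ := ZMod.intCast_surjective a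
      exact ⟨k, (hzp k).symm⟩
    have hcomm' : ∀ a, E a * y = y * E (-a) := fun a => by
      obtain ⟨k, rfl⟩ := ZMod.intCast_surjective a
      have : SemiconjBy y x⁻¹ x := (hconj y hy).symm
      have := (this.zpow_right k).eq
      rw [hzp, ← Int.cast_neg, hzp, zpow_neg, ← inv_zpow, this]
    have hyy : y * y = E 2 := by
      have := hzp 2
      push_cast at this
      rw [this, ← sq, hsq' y hy, zpow_ofNat]
    have hE0 : E 0 = 1 := by simp [E]
    let f : QuaternionGroup 2 →* P := MonoidHom.mk'
      (fun
        | .a k => E k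
        | .xa k => y * E k) (by
      rintro (a | a) (b | b)
      · simp [hadd]
      · simp only [QuaternionGroup.a_mul_xa, ← mul_assoc, hcomm', sub_eq_neg_add, hadd]
      · simp only [QuaternionGroup.xa_mul_a, mul_assoc, hadd]
      · simp only [QuaternionGroup.xa_mul_xa]
        rw [mul_assoc, ← mul_assoc (E a), hcomm', mul_assoc, ← mul_assoc, hyy, ← hadd, ← hadd]
        congr 1
        push_cast
        ring)
    refine ⟨(MulEquiv.ofBijective f ⟨?_, ?_⟩).symm⟩
    · rw [injective_iff_map_eq_one]
      rintro (a | a) ha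
      · rw [hE (ha.trans hE0.symm)]
        rfl
      · refine absurd ?_ hy
        rw [eq_inv_of_mul_eq_one_left ha]
        exact inv_mem (hmem a)
    · have hsurj : ∀ w ∈ Subgroup.zpowers x, ∃ a, E a = w := by
        rintro _ ⟨k, rfl⟩
        exact ⟨k, hzp k⟩
      intro w
      by_cases hw : w ∈ Subgroup.zpowers x
      · obtain ⟨a, ha⟩ := hsurj w hw
        exact ⟨.a a, ha⟩
      · obtain ⟨a, ha⟩ := hsurj (y⁻¹ * w) (hcent _ (by
          have h1 : SemiconjBy y⁻¹ x x⁻¹ :=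
            SemiconjBy.inv_symm_left (show SemiconjBy y x⁻¹ x from (hconj y hy).symm)
          have h2 : SemiconjBy w x⁻¹ x := (hconj w hw).symm
          simpa using (h1.mul_left h2).inv_right.eq))
        exact ⟨.xa a, by rw [eq_inv_mul_iff_mul_eq] at ha; exact ha⟩

/-- If a finite group has the 5- or 6-BCI property, then its Sylow 2-subgroups are
elementary abelian, cyclic, or generalized quaternion. -/
theorem sylow_two_of_five_or_six_BCI (G : Type*) [Group G] [Finite G]
    (hBCI : IsmBCIGroup G 5 ∨ IsmBCIGroup G 6) (P : Sylow 2 G) :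
    ((∀ x y : (P : Subgroup G), x * y = y * x) ∧
      (∀ x : (P : Subgroup G), x ^ 2 = 1)) ∨
    IsCyclic (P : Subgroup G) ∨
    (∃ n : ℕ, 0 < n ∧ Nonempty ((P : Subgroup G) ≃* QuaternionGroup n)) := by
  have h4 : IsmBCIGroup G 4 := fun S hS => by
    rcases hBCI with h | h <;> exact h S (hS.trans (by norm_num))
  have h3 : IsmBCIGroup G 3 := fun S hS => h4 S (hS.trans (by norm_num))
  by_cases hexp : ∀ w : (P : Subgroup G), w ^ 2 = 1
  · exact Or.inl ⟨fun u v => Commute.of_orderOf_dvd_two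
      (fun w => orderOf_dvd_of_pow_eq_one (hexp w)) u v, hexp⟩
  · right
    push Not at hexp
    obtain ⟨x, hx⟩ := hexp
    have hpow : ∀ w : (P : Subgroup G), w ^ 4 = 1 := by
      intro w
      obtain ⟨k, hk⟩ := P.isPGroup'.exists_orderOf_eq_pow w
      rcases le_or_gt k 2 with hk2 | hk2
      · apply orderOf_dvd_iff_pow_eq_one.1
        rw [hk]
        exact pow_dvd_pow 2 hk2
      · refine absurd ?_ (h4.orderOf_ne_eight ((w : G) ^ 2 ^ (k - 3)))
        have hw : orderOf (w : G) = 2 ^ (k - 3) * 8 := by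
          rw [Subgroup.orderOf_coe, hk, show 8 = 2 ^ 3 by rfl, ← pow_add, Nat.sub_add_cancel hk2]
        rw [orderOf_pow_of_dvd (by positivity) (hw ▸ Dvd.intro _ rfl), hw]
        simp
    have hx4 : orderOf (x : G) = 4 := by
      have := orderOf_eq_prime_pow (p := 2) (n := 1) (x := x) (by simpa using hx)
        (by simpa using hpow x)
      simpa using this
    refine (isCyclic_or_quaternion hpow ?_ hx).imp_right fun h => ⟨2, by norm_num, h⟩
    intro u v hu hv huv hu1 hv1
    exact Subtype.ext (h3.eq_of_commute_involutions hx4 (congrArg Subtype.val hu)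
      (congrArg Subtype.val hv) (congrArg Subtype.val huv) (by simpa using hu1)
      (by simpa using hv1))
end

section
/- Let p > 2 be a prime and n ≥ 2p + 3 an integer. Then the elementary abelian group (ℤ_p)^n is not a BCI-group. -/
open SimpleGraph

/-- A shear of `U × V` by a map `f` that is additive in each direction `u ∈ A` modulo `W u`
gives isomorphic bi-Cayley graphs. They are not equivalent when `A` has no three-term
arithmetic progression and no additive map agrees with `f` on `A` modulo the subgroups `W u`. -/
theorem not_isBCIGroup_of_shear {G U V : Type*} [AddCommGroup G] [AddCommGroup U] [Finite U]
    [AddCommGroup V] (e : G ≃+ U × V) (f : U → V) (A : Set U) (W : U → AddSubgroup V)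
    (hf : ∀ u ∈ A, ∀ x, f (x + u) - f x - f u ∈ W u)
    (h0 : (0 : U) ∈ A) (hf0 : f 0 = 0) (hW0 : ∀ v ∈ W 0, v = 0)
    (hA : ∀ a z, a ∈ A → a + z ∈ A → a + (z + z) ∈ A → z = 0)
    (hW : ∀ v, ∃ u₁ ∈ A, ∃ u₂ ∈ A, ∃ w₁ ∈ W u₁, ∃ w₂ ∈ W u₂, v = w₁ + w₂)
    (hl : ∀ l : U →+ V, ∃ u ∈ A, l u - f u ∉ W u) :
    ¬ IsBCIGroup (Multiplicative G) := by
  intro hG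
  let S : Set (Multiplicative G) := {g | (e g.toAdd).1 ∈ A ∧ (e g.toAdd).2 ∈ W (e g.toAdd).1}
  let T : Set (Multiplicative G) :=
    {g | (e g.toAdd).1 ∈ A ∧ (e g.toAdd).2 - f (e g.toAdd).1 ∈ W (e g.toAdd).1}
  let shear : U × V ≃ U × V :=
    { toFun := fun z => (z.1, z.2 + f z.1)
      invFun := fun z => (z.1, z.2 - f z.1)
      left_inv := fun z => by simp
      right_inv := fun z => by simp }
  let φ : Multiplicative G ≃ Multiplicative G :=
    Multiplicative.toAdd.trans
      ((e.toEquiv.trans (shear.trans e.symm.toEquiv)).trans Multiplicative.ofAdd)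
  have hφ : ∀ x, e (φ x).toAdd = ((e x.toAdd).1, (e x.toAdd).2 + f (e x.toAdd).1) := by
    intro x
    simp [φ, shear]
  have hST : ∀ x y, φ y * (φ x)⁻¹ ∈ T ↔ y * x⁻¹ ∈ S := by
    intro x y
    simp only [S, T, Set.mem_ofPred_eq, toAdd_mul, toAdd_inv, map_add, map_neg, hφ, Prod.fst_add,
      Prod.snd_add, Prod.fst_neg, Prod.snd_neg]
    refine and_congr_right fun hu => ?_
    have h := hf _ hu (e x.toAdd).1
    rw [show (e x.toAdd).1 + ((e y.toAdd).1 + -(e x.toAdd).1) = (e y.toAdd).1 by abel] at h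
    refine Iff.trans (iff_of_eq (congrArg (· ∈ _) ?_)) (AddSubgroup.add_mem_cancel_right _ h)
    abel
  have hiso : Nonempty (BCay (Multiplicative G) S ≃g BCay (Multiplicative G) T) := by
    refine ⟨⟨φ.prodCongr (Equiv.refl _), ?_⟩⟩
    intro a b
    simp only [BCay, SimpleGraph.fromRel_adj, (φ.prodCongr (Equiv.refl _)).injective.ne_iff]
    simp only [Equiv.prodCongr_apply, Prod.map_snd, Prod.map_fst, Equiv.refl_apply, hST]
  obtain ⟨g, α', hT⟩ := hG S T hiso
  let α : U × V →+ U × V :=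
    (e.toAddMonoidHom.comp (MulEquiv.toAdditive α').toAddMonoidHom).comp e.symm.toAddMonoidHom
  let c : U × V := e g.toAdd
  have hα : ∀ x, α x = e (α' (Multiplicative.ofAdd (e.symm x))).toAdd := fun x => rfl
  have hαsurj : Function.Surjective α := by
    intro y
    refine ⟨e (α'.symm (Multiplicative.ofAdd (e.symm y))).toAdd, ?_⟩
    simp [hα]
  have hmaps : ∀ u v, u ∈ A → v ∈ W u →
      (c + α (u, v)).1 ∈ A ∧ (c + α (u, v)).2 - f (c + α (u, v)).1 ∈ W (c + α (u, v)).1 := by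
    intro u v hu hv
    have hm : g * α' (Multiplicative.ofAdd (e.symm (u, v))) ∈ T := by
      rw [hT]
      exact ⟨_, by simp [S, hu, hv], rfl⟩
    simpa [T, c, hα] using hm
  have honto : ∀ u ∈ A, ∃ s, s.1 ∈ A ∧ s.2 ∈ W s.1 ∧ c + α s = (u, f u) := by
    intro u hu
    have hm : Multiplicative.ofAdd (e.symm (u, f u)) ∈ T := by
      simp [T, hu, (W u).zero_mem]
    rw [hT] at hm
    obtain ⟨s, hs, hs'⟩ := hm
    refine ⟨e s.toAdd, hs.1, hs.2, ?_⟩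
    have := congrArg (fun x => e x.toAdd) hs'
    simpa [c, hα] using this
  have hfibW : ∀ u ∈ A, ∀ w ∈ W u, (α (0, w)).1 = 0 := by
    intro u hu w hw
    have h₁ : α (u, w) = α (u, 0) + α (0, w) := by rw [← map_add]; simp
    have h₂ : α (u, w + w) = α (u, 0) + (α (0, w) + α (0, w)) := by
      rw [← map_add, ← map_add]; simp
    refine hA (c + α (u, 0)).1 _ (hmaps u 0 hu (W u).zero_mem).1 ?_ ?_
    · simpa [h₁, add_assoc] using (hmaps u w hu hw).1
    · simpa [h₂, add_assoc] using (hmaps u (w + w) hu ((W u).add_mem hw hw)).1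
  have hfib : ∀ v, (α (0, v)).1 = 0 := by
    intro v
    obtain ⟨u₁, hu₁, u₂, hu₂, w₁, hw₁, w₂, hw₂, rfl⟩ := hW v
    have : α (0, w₁ + w₂) = α (0, w₁) + α (0, w₂) := by rw [← map_add]; simp
    simp [this, hfibW u₁ hu₁ w₁ hw₁, hfibW u₂ hu₂ w₂ hw₂]
  have hfst : ∀ u v, (α (u, v)).1 = (α (u, 0)).1 := by
    intro u v
    have : α (u, v) = α (u, 0) + α (0, v) := by rw [← map_add]; simp
    simp [this, hfib]
  let a : U →+ U := (AddMonoidHom.fst U V).comp (α.comp (AddMonoidHom.inl U V))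
  have ha : ∀ u, a u = (α (u, 0)).1 := fun u => rfl
  have hasurj : Function.Surjective a := by
    intro u
    obtain ⟨⟨x, v⟩, hx⟩ := hαsurj (u, 0)
    exact ⟨x, by rw [ha, ← hfst x v, hx]⟩
  let aEquiv : U ≃+ U :=
    AddEquiv.ofBijective a ⟨Finite.injective_iff_surjective.mpr hasurj, hasurj⟩
  let l : U →+ V :=
    ((AddMonoidHom.snd U V).comp (α.comp (AddMonoidHom.inl U V))).comp
      aEquiv.symm.toAddMonoidHom
  have hla : ∀ u, l (a u) = (α (u, 0)).2 := by
    intro u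
    have : aEquiv.symm (a u) = u := aEquiv.symm_apply_apply u
    simp [l, this]
  have hlift : ∀ u ∈ A, ∃ x, (c + α (x, 0)).1 = u ∧ (c + α (x, 0)).2 - f u ∈ W u := by
    intro u hu
    obtain ⟨⟨x, v⟩, hx, -, hs⟩ := honto u hu
    have h₁ : (c + α (x, 0)).1 = u := by
      have := congrArg Prod.fst hs
      simpa [hfst x v] using this
    have h₂ := (hmaps x 0 hx (W x).zero_mem).2
    rw [h₁] at h₂
    exact ⟨x, h₁, h₂⟩
  obtain ⟨x₀, hx₀, hx₀'⟩ := hlift 0 h0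
  rw [hf0, sub_zero] at hx₀'
  have hc : c = -α (x₀, 0) := eq_neg_of_add_eq_zero_left (Prod.ext hx₀ (hW0 _ hx₀'))
  obtain ⟨u, hu, hlu⟩ := hl l
  obtain ⟨x, hx, hx'⟩ := hlift u hu
  have hcx : c + α (x, 0) = α (x - x₀, 0) := by
    rw [hc, neg_add_eq_sub, ← map_sub]; simp
  rw [hcx] at hx hx'
  apply hlu
  rwa [← hx, ← ha, hla, ha, hx]

/-- The carry in the addition of the representatives of `x` and `y`. -/
def carry {p : ℕ} (x y : ZMod p) : ℤ := ((x.val : ℤ) + y.val - (x + y).val) / p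

/-- Minus the carry in the addition of the representatives of all the `x i`. -/
def negCarrySum {p : ℕ} {ι : Type*} [Fintype ι] (x : ι → ZMod p) : ℤ :=
  (((∑ i, x i).val : ℤ) - ∑ i, ((x i).val : ℤ)) / p

theorem mul_carry {p : ℕ} [NeZero p] (x y : ZMod p) :
    (p : ℤ) * carry x y = (x.val : ℤ) + y.val - (x + y).val := by
  refine Int.mul_ediv_cancel' ((ZMod.intCast_zmod_eq_zero_iff_dvd _ p).mp ?_)
  simp

theorem mul_negCarrySum {p : ℕ} [NeZero p] {ι : Type*} [Fintype ι] (x : ι → ZMod p) :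
    (p : ℤ) * negCarrySum x = ((∑ i, x i).val : ℤ) - ∑ i, ((x i).val : ℤ) := by
  refine Int.mul_ediv_cancel' ((ZMod.intCast_zmod_eq_zero_iff_dvd _ p).mp ?_)
  simp

theorem carry_add_negCarrySum_add_single {p : ℕ} [NeZero p] {ι : Type*} [Fintype ι]
    [DecidableEq ι] (i : ι) (c : ZMod p) (x : ι → ZMod p) :
    carry ((x + Pi.single i c : ι → ZMod p) i)
        (∑ j, (x + Pi.single i c : ι → ZMod p) j - (x + Pi.single i c : ι → ZMod p) i)
      + negCarrySum (x + Pi.single i c) = carry (x i) (∑ j, x j - x i) + negCarrySum x := by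
  have hp : (p : ℤ) ≠ 0 := by exact_mod_cast NeZero.ne p
  apply mul_left_cancel₀ hp
  have hsum : ∑ j, (x + Pi.single i c : ι → ZMod p) j - (x + Pi.single i c : ι → ZMod p) i
      = ∑ j, x j - x i := by
    simp [Finset.sum_add_distrib]
  have hval : ∑ j, (((x + Pi.single i c : ι → ZMod p) j).val : ℤ)
      - (((x + Pi.single i c : ι → ZMod p) i).val : ℤ)
      = ∑ j, ((x j).val : ℤ) - ((x i).val : ℤ) := by
    rw [← Finset.add_sum_erase _ _ (Finset.mem_univ i),
      ← Finset.add_sum_erase _ (fun j => ((x j).val : ℤ)) (Finset.mem_univ i),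
      add_sub_cancel_left, add_sub_cancel_left]
    refine Finset.sum_congr rfl fun j hj => ?_
    simp [Finset.ne_of_mem_erase hj]
  rw [mul_add, mul_add, mul_carry, mul_carry, mul_negCarrySum, mul_negCarrySum,
    add_sub_cancel, add_sub_cancel, hsum]
  linarith

theorem sum_carry_add_negCarrySum_add_one {p : ℕ} [NeZero p]
    (x : Fin (p + 1) → ZMod p) :
    ((∑ i, carry ((x + 1) i) (∑ j, (x + 1) j - (x + 1) i) + negCarrySum (x + 1) : ℤ) : ZMod p)
      = ((∑ i, carry (x i) (∑ j, x j - x i) + negCarrySum x : ℤ) : ZMod p) - 1 := by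
  have hp : (p : ℤ) ≠ 0 := by exact_mod_cast NeZero.ne p
  have key : ∀ y : Fin (p + 1) → ZMod p,
      (p : ℤ) * (∑ i, carry (y i) (∑ j, y j - y i) + negCarrySum y)
        = ∑ i, ((∑ j, y j - y i).val : ℤ) - p * (∑ j, y j).val := by
    intro y
    simp only [mul_add, Finset.mul_sum, mul_carry, mul_negCarrySum, add_sub_cancel,
      Finset.sum_sub_distrib, Finset.sum_add_distrib, Finset.sum_const, Finset.card_univ,
      Fintype.card_fin, nsmul_eq_mul]
    push_cast
    ring
  have hs : ∑ j, (x + 1) j = ∑ j, x j + 1 := by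
    simp [Finset.sum_add_distrib]
  have hdiff : ∀ i, ∑ j, (x + 1) j - (x + 1) i = ∑ j, x j - x i := by
    intro i
    rw [hs]
    simp
  have h : ∑ i, carry ((x + 1) i) (∑ j, (x + 1) j - (x + 1) i) + negCarrySum (x + 1)
      = ∑ i, carry (x i) (∑ j, x j - x i) + negCarrySum x
        - (((∑ j, x j + 1).val : ℤ) - (∑ j, x j).val) := by
    apply mul_left_cancel₀ hp
    rw [mul_sub, key, key, hs]
    simp only [← hs, hdiff]
    ring
  rw [h]
  push_cast
  simp

/-- The vector of carries, all of whose components vanish at `0`. -/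
def carryMap (p k : ℕ) (x : Fin (p + 1) → ZMod p) :
    (Fin (p + 1) → ZMod p) × (Fin (k + 1) → ZMod p) :=
  (fun i => (carry (x i) (∑ j, x j - x i) : ZMod p), fun _ => (negCarrySum x : ZMod p))

theorem carryMap_zero (p k : ℕ) : carryMap p k 0 = 0 := by
  ext <;> simp [carryMap, carry, negCarrySum]

/-- The directions in which the bi-Cayley graph has edges. -/
def carryDirections (p : ℕ) : Set (Fin (p + 1) → ZMod p) :=
  {u | (∃ i, u = Pi.single i 1) ∨ u = 1 ∨ (∃ i, u = Pi.single i 1 - Pi.single 0 1) ∨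
    ∃ i, i ≠ 0 ∧ u = Pi.single i 1 - Pi.single 1 1}

/-- The subgroup modulo which `carryMap` is additive in the direction `u`. -/
def carrySubgroup (p k : ℕ) (u : Fin (p + 1) → ZMod p) :
    AddSubgroup ((Fin (p + 1) → ZMod p) × (Fin (k + 1) → ZMod p)) where
  carrier := {v | (u = 0 → v = 0) ∧ (∀ i, u = Pi.single i 1 → v.1 i + v.2 0 = 0) ∧
    (u = 1 → ∑ i, v.1 i + v.2 0 = 0) ∧
    (∀ i j, j ≠ i → j ≠ 0 → u = Pi.single i 1 - Pi.single 0 1 → v.1 j = 0) ∧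
    ∀ i, i ≠ 0 → u = Pi.single i 1 - Pi.single 1 1 → v.1 0 = 0}
  zero_mem' := by simp
  add_mem' := by
    rintro v w ⟨h1, h2, h3, h4, h5⟩ ⟨g1, g2, g3, g4, g5⟩
    refine ⟨fun h => by simp [h1 h, g1 h], fun i h => ?_, fun h => ?_,
      fun i j hj hj' h => by simp [h4 i j hj hj' h, g4 i j hj hj' h],
      fun i hi h => by simp [h5 i hi h, g5 i hi h]⟩
    · simpa [add_add_add_comm] using congrArg₂ (· + ·) (h2 i h) (g2 i h)
    · simpa [Finset.sum_add_distrib, add_add_add_comm] using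
        congrArg₂ (· + ·) (h3 h) (g3 h)
  neg_mem' := by
    rintro v ⟨h1, h2, h3, h4, h5⟩
    refine ⟨fun h => by simp [h1 h], fun i h => ?_, fun h => ?_,
      fun i j hj hj' h => by simp [h4 i j hj hj' h], fun i hi h => by simp [h5 i hi h]⟩
    · simpa [add_comm] using congrArg Neg.neg (h2 i h)
    · simpa [add_comm] using congrArg Neg.neg (h3 h)

theorem carryMap_add_single (p k : ℕ) [NeZero p] (i : Fin (p + 1)) (x : Fin (p + 1) → ZMod p) :
    (carryMap p k (x + Pi.single i 1)).1 i + (carryMap p k (x + Pi.single i 1)).2 0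
      = (carryMap p k x).1 i + (carryMap p k x).2 0 := by
  have := congrArg (Int.cast : ℤ → ZMod p) (carry_add_negCarrySum_add_single i 1 x)
  push_cast at this
  exact this

theorem carryMap_add_one (p k : ℕ) [NeZero p] (x : Fin (p + 1) → ZMod p) :
    ∑ i, (carryMap p k (x + 1)).1 i + (carryMap p k (x + 1)).2 0
      = ∑ i, (carryMap p k x).1 i + (carryMap p k x).2 0 - 1 := by
  have := sum_carry_add_negCarrySum_add_one x
  push_cast at this
  exact this

theorem carryMap_add_of_eq_zero (p k : ℕ) (j : Fin (p + 1)) (x u : Fin (p + 1) → ZMod p)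
    (hj : u j = 0) (hu : ∑ i, u i = 0) :
    (carryMap p k (x + u)).1 j = (carryMap p k x).1 j := by
  simp [carryMap, Finset.sum_add_distrib, hj, hu]

theorem fin_zero_ne_one {p : ℕ} (hp : 2 < p) : (0 : Fin (p + 1)) ≠ 1 := by
  obtain ⟨m, rfl⟩ := Nat.exists_eq_add_of_lt hp
  exact zero_ne_one

theorem sum_single_sub_single {p : ℕ} (i j : Fin (p + 1)) :
    ∑ l, (Pi.single i 1 - Pi.single j 1 : Fin (p + 1) → ZMod p) l = 0 := by
  simp

theorem carryMap_sub_mem_carrySubgroup (p k : ℕ) (hp : 2 < p) (u x : Fin (p + 1) → ZMod p) :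
    carryMap p k (x + u) - carryMap p k x - carryMap p k u ∈ carrySubgroup p k u := by
  have : NeZero p := ⟨by omega⟩
  have h01 := fin_zero_ne_one hp
  refine ⟨?_, ?_, ?_, ?_, ?_⟩
  · rintro rfl
    simp [carryMap_zero]
  · rintro i rfl
    have h := carryMap_add_single p k i x
    have h' := carryMap_add_single p k i 0
    simp only [zero_add, carryMap_zero, Prod.fst_zero, Prod.snd_zero, Pi.zero_apply] at h'
    simp only [Prod.fst_sub, Prod.snd_sub, Pi.sub_apply]
    linear_combination h - h'
  · rintro rfl
    have h := carryMap_add_one p k x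
    have h' := carryMap_add_one p k 0
    simp only [zero_add, carryMap_zero, Prod.fst_zero, Prod.snd_zero, Pi.zero_apply,
      Finset.sum_const_zero] at h'
    simp only [Prod.fst_sub, Prod.snd_sub, Pi.sub_apply, Finset.sum_sub_distrib]
    linear_combination h - h'
  · rintro i j hji hj0 rfl
    have hz : (Pi.single i 1 - Pi.single 0 1 : Fin (p + 1) → ZMod p) j = 0 := by
      simp [hji, hj0]
    have h := carryMap_add_of_eq_zero p k j x _ hz (sum_single_sub_single i 0)
    have h' := carryMap_add_of_eq_zero p k j 0 _ hz (sum_single_sub_single i 0)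
    rw [zero_add, carryMap_zero] at h'
    simp [h, h']
  · rintro i hi rfl
    have hz : (Pi.single i 1 - Pi.single 1 1 : Fin (p + 1) → ZMod p) 0 = 0 := by
      simp [hi.symm, h01]
    have h := carryMap_add_of_eq_zero p k 0 x _ hz (sum_single_sub_single i 1)
    have h' := carryMap_add_of_eq_zero p k 0 0 _ hz (sum_single_sub_single i 1)
    rw [zero_add, carryMap_zero] at h'
    simp [h, h']

theorem mem_carrySubgroup_single {p k : ℕ} (hp : 2 < p) (i : Fin (p + 1))
    (v : (Fin (p + 1) → ZMod p) × (Fin (k + 1) → ZMod p)) (hv : v.1 i + v.2 0 = 0) :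
    v ∈ carrySubgroup p k (Pi.single i 1) := by
  have : Fact (1 < p) := ⟨by omega⟩
  have hsum : ∑ j, (Pi.single i 1 : Fin (p + 1) → ZMod p) j = 1 := by simp
  refine ⟨fun h => ?_, fun j h => ?_, fun h => ?_, fun j _ _ _ h => ?_, fun j _ h => ?_⟩
  · simp at h
  · have hji : j = i := by
      by_contra hji
      have := congrFun h j
      simp [hji] at this
    rwa [hji]
  · have : Nontrivial (Fin (p + 1)) := ⟨0, 1, fin_zero_ne_one hp⟩
    obtain ⟨j, hj⟩ := exists_ne i
    have := congrFun h j
    simp [hj] at this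
  · rw [h, sum_single_sub_single] at hsum
    exact absurd hsum zero_ne_one
  · rw [h, sum_single_sub_single] at hsum
    exact absurd hsum zero_ne_one

theorem eq_zero_of_three_terms {p : ℕ} [Fact p.Prime] (hp : 2 < p) {a b c d : ZMod p}
    (h0 : a = c ∨ a = d) (h1 : a + b = c ∨ a + b = d) (h2 : a + (b + b) = c ∨ a + (b + b) = d) :
    b = 0 := by
  have : Fact (2 < p) := ⟨hp⟩
  have htwo : (2 : ZMod p) ≠ 0 := Ring.two_ne_zero (by rw [ZMod.ringChar_zmod_n]; omega)
  have hdouble : b + b = 0 → b = 0 := by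
    intro h
    rw [← two_mul] at h
    exact (mul_eq_zero.mp h).resolve_left htwo
  grind

theorem carryDirections_threeAP_free (p : ℕ) [Fact p.Prime] (hp : 2 < p)
    (a z : Fin (p + 1) → ZMod p) (h0 : a ∈ carryDirections p) (h1 : a + z ∈ carryDirections p)
    (h2 : a + (z + z) ∈ carryDirections p) : z = 0 := by
  have hsum : ∀ u ∈ carryDirections p, ∑ i, u i = 0 ∨ ∑ i, u i = 1 := by
    rintro u (⟨i, rfl⟩ | rfl | ⟨i, rfl⟩ | ⟨i, -, rfl⟩) <;> simp
  have hzsum : ∑ i, z i = 0 := by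
    have h1' := hsum _ h1
    have h2' := hsum _ h2
    simp only [Pi.add_apply, Finset.sum_add_distrib] at h1' h2'
    exact eq_zero_of_three_terms hp (hsum _ h0) h1' h2'
  have hs1 : ∑ i, (a + z) i = ∑ i, a i := by simp [Finset.sum_add_distrib, hzsum]
  have hs2 : ∑ i, (a + (z + z)) i = ∑ i, a i := by simp [Finset.sum_add_distrib, hzsum]
  rcases hsum _ h0 with hs | hs
  · have hzero : ∀ u ∈ carryDirections p, ∑ i, u i = 0 →
        (u 0 = 0 ∨ u 0 = -1) ∧ ∀ i, i ≠ 0 → i ≠ 1 → u i = 0 ∨ u i = 1 := by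
      have h01 := fin_zero_ne_one hp
      rintro u (⟨i, rfl⟩ | rfl | ⟨i, rfl⟩ | ⟨i, hi, rfl⟩) hu
      · simp at hu
      · simp at hu
      · refine ⟨?_, fun j hj0 hj1 => ?_⟩
        · by_cases h : i = 0
          · simp [h]
          · simp [Ne.symm h]
        · by_cases h : j = i
          · subst h; simp [hj0]
          · simp [h, hj0]
      · refine ⟨by simp [hi.symm, h01], fun j hj0 hj1 => ?_⟩
        by_cases h : j = i
        · subst h; simp [hj1]
        · simp [h, hj1]
    have k0 := hzero _ h0 hs
    have k1 := hzero _ h1 (hs1.trans hs)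
    have k2 := hzero _ h2 (hs2.trans hs)
    have hz : ∀ i, i ≠ 1 → z i = 0 := by
      intro i hi
      by_cases h : i = 0
      · subst h
        exact eq_zero_of_three_terms hp k0.1 k1.1 k2.1
      · exact eq_zero_of_three_terms hp (k0.2 i h hi) (k1.2 i h hi) (k2.2 i h hi)
    have hz1 : z 1 = 0 := by
      rwa [Finset.sum_eq_single 1 (fun i _ hi => hz i hi) (by simp)] at hzsum
    funext i
    by_cases h : i = 1
    · simpa [h] using hz1
    · exact hz i h
  · have hmem : ∀ u ∈ carryDirections p, ∑ i, u i = 1 → ∀ i, u i = 0 ∨ u i = 1 := by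
      rintro u (⟨i, rfl⟩ | rfl | ⟨i, rfl⟩ | ⟨i, hi, rfl⟩) hu j
      · by_cases h : j = i
        · subst h; simp
        · simp [h]
      · simp
      · simp at hu
      · simp at hu
    funext i
    exact eq_zero_of_three_terms hp (hmem _ h0 hs i) (hmem _ h1 (hs1.trans hs) i)
      (hmem _ h2 (hs2.trans hs) i)

theorem exists_sub_carryMap_notMem (p k : ℕ) [Fact p.Prime] (hp : 2 < p)
    (l : (Fin (p + 1) → ZMod p) →+ (Fin (p + 1) → ZMod p) × (Fin (k + 1) → ZMod p)) :
    ∃ u ∈ carryDirections p, l u - carryMap p k u ∉ carrySubgroup p k u := by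
  by_contra! hl
  have h01 := fin_zero_ne_one hp
  let E : Fin (p + 1) → Fin (p + 1) → ZMod p := fun i => Pi.single i 1
  have hdiag : ∀ i, (l (E i)).1 i + (l (E i)).2 0 = 0 := by
    intro i
    have h := (hl (E i) (Or.inl ⟨i, rfl⟩)).2.1 i rfl
    have h' := carryMap_add_single p k i 0
    simp only [zero_add, carryMap_zero, Prod.fst_zero, Prod.snd_zero, Pi.zero_apply] at h'
    simp only [Prod.fst_sub, Prod.snd_sub, Pi.sub_apply] at h
    linear_combination h + h'
  have hone : ∑ i, (l 1).1 i + (l 1).2 0 = -1 := by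
    have h := (hl 1 (Or.inr (Or.inl rfl))).2.2.1 rfl
    have h' := carryMap_add_one p k 0
    simp only [zero_add, carryMap_zero, Prod.fst_zero, Prod.snd_zero, Pi.zero_apply,
      Finset.sum_const_zero] at h'
    simp only [Prod.fst_sub, Prod.snd_sub, Pi.sub_apply, Finset.sum_sub_distrib] at h
    linear_combination h + h'
  have hoff : ∀ i j, j ≠ i → j ≠ 0 → (l (E i)).1 j = (l (E 0)).1 j := by
    intro i j hji hj0
    have h := (hl _ (Or.inr (Or.inr (Or.inl ⟨i, rfl⟩)))).2.2.2.1 i j hji hj0 rfl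
    have h' := carryMap_add_of_eq_zero p k j 0 (Pi.single i 1 - Pi.single 0 1)
      (by simp [hji, hj0]) (sum_single_sub_single i 0)
    rw [zero_add, carryMap_zero] at h'
    rw [map_sub] at h
    simpa [h', sub_eq_zero] using h
  have hoff0 : ∀ i, i ≠ 0 → (l (E i)).1 0 = (l (E 1)).1 0 := by
    intro i hi
    have h := (hl _ (Or.inr (Or.inr (Or.inr ⟨i, hi, rfl⟩)))).2.2.2.2 i hi rfl
    have h' := carryMap_add_of_eq_zero p k 0 0 (Pi.single i 1 - Pi.single 1 1)
      (by simp [hi.symm, h01]) (sum_single_sub_single i 1)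
    rw [zero_add, carryMap_zero] at h'
    rw [map_sub] at h
    simpa [h', sub_eq_zero] using h
  let b : Fin (p + 1) → ZMod p := fun j => if j = 0 then (l (E 1)).1 0 else (l (E 0)).1 j
  have hentry : ∀ i j, (l (E i)).1 j
      = b j + if i = j then -(l (E j)).2 0 - b j else 0 := by
    intro i j
    by_cases hij : i = j
    · subst hij
      simp only [if_true]
      linear_combination hdiag i
    · rw [if_neg hij, add_zero]
      by_cases hj : j = 0
      · subst hj
        simp [b, hoff0 i hij]
      · simp [b, hj, hoff i j (Ne.symm hij) hj]
  have hsum : l 1 = ∑ i, l (E i) := by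
    rw [← map_sum]
    congr 1
    exact (Finset.univ_sum_single (1 : Fin (p + 1) → ZMod p)).symm
  have hcol : ∀ j, (l 1).1 j = -(l (E j)).2 0 := by
    intro j
    rw [hsum, Prod.fst_sum, Finset.sum_apply]
    simp only [hentry, Finset.sum_add_distrib]
    simp
  have hlast : (l 1).2 0 = ∑ j, (l (E j)).2 0 := by
    rw [hsum, Prod.snd_sum, Finset.sum_apply]
  rw [hlast] at hone
  simp [hcol] at hone

/-- For an odd prime `p` and `n ≥ 2p + 3`, the elementary abelian group `(ℤ_p)^n`
is not a BCI-group. -/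
theorem elementary_abelian_not_BCIGroup (p n : ℕ) (hp : p.Prime) (hp2 : 2 < p)
    (hn : 2 * p + 3 ≤ n) :
    ¬ IsBCIGroup (Multiplicative (Fin n → ZMod p)) := by
  have : Fact p.Prime := ⟨hp⟩
  obtain ⟨k, rfl⟩ := Nat.exists_eq_add_of_le hn
  have h01 := fin_zero_ne_one hp2
  let e : (Fin (2 * p + 3 + k) → ZMod p) ≃ₗ[ZMod p]
      (Fin (p + 1) → ZMod p) × ((Fin (p + 1) → ZMod p) × (Fin (k + 1) → ZMod p)) :=
    LinearEquiv.ofFinrankEq _ _ (by simp; ring)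
  refine not_isBCIGroup_of_shear e.toAddEquiv (carryMap p k) (carryDirections p)
    (carrySubgroup p k) (fun u _ x => carryMap_sub_mem_carrySubgroup p k hp2 u x)
    (Or.inr (Or.inr (Or.inl ⟨0, by simp⟩))) (carryMap_zero p k) (fun v hv => hv.1 rfl)
    (carryDirections_threeAP_free p hp2) ?_ (exists_sub_carryMap_notMem p k hp2)
  intro v
  refine ⟨Pi.single 1 1, Or.inl ⟨1, rfl⟩, Pi.single 0 1, Or.inl ⟨0, rfl⟩,
    (Pi.single 0 (v.1 0 + v.2 0), 0), mem_carrySubgroup_single hp2 1 _ (by simp [h01.symm]),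
    v - (Pi.single 0 (v.1 0 + v.2 0), 0), mem_carrySubgroup_single hp2 0 _ (by simp), by simp⟩
end

section
/- Let G be a finite BCI-group and H a characteristic subgroup of G. Then H is also a BCI-group. -/
open SimpleGraph

theorem BCay_adj {G : Type*} [Group G] {S : Set G} {u v : G × Fin 2} :
    (BCay G S).Adj u v ↔ (u.2 = 0 ∧ v.2 = 1 ∧ v.1 * u.1⁻¹ ∈ S) ∨
      (v.2 = 0 ∧ u.2 = 1 ∧ u.1 * v.1⁻¹ ∈ S) := by
  rw [BCay, SimpleGraph.fromRel_adj, and_iff_right_iff_imp]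
  rintro (⟨h0, h1, -⟩ | ⟨h0, h1, -⟩) rfl <;> simp [h0] at h1

/-- The splitting of the vertices of a bi-Cayley graph over `G` into copies of the vertex set over
`H`, indexed by a right transversal `R` of `H`. -/
noncomputable def Subgroup.IsComplement.vertexEquiv {G : Type*} [Group G] {H : Subgroup G}
    {R : Set G} (hR : Subgroup.IsComplement (H : Set G) R) :
    G × Fin 2 ≃ R × (H × Fin 2) :=
  ((hR.equiv.trans (Equiv.prodComm _ _)).prodCongr (Equiv.refl _)).trans (Equiv.prodAssoc _ _ _)

theorem Subgroup.IsComplement.mul_inv_mem_image_iff {G : Type*} [Group G] {H : Subgroup G}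
    {R : Set G} (hR : Subgroup.IsComplement (H : Set G) R) (S : Set H) (x y : G) :
    y * x⁻¹ ∈ Subtype.val '' S ↔ (hR.equiv x).2 = (hR.equiv y).2 ∧
      ((hR.equiv y).1 : H) * ((hR.equiv x).1 : H)⁻¹ ∈ S := by
  constructor
  · rintro ⟨s, hs, h⟩
    obtain rfl : y = s * x := by rw [h]; group
    rw [hR.equiv_mul_left]
    refine ⟨rfl, ?_⟩
    simpa using hs
  · rintro ⟨h, hs⟩
    refine ⟨_, hs, ?_⟩
    conv_rhs => rw [← hR.equiv_fst_mul_equiv_snd x, ← hR.equiv_fst_mul_equiv_snd y, h]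
    simp [mul_assoc]

theorem Subgroup.IsComplement.BCay_image_adj_iff {G : Type*} [Group G] {H : Subgroup G}
    {R : Set G} (hR : Subgroup.IsComplement (H : Set G) R) (S : Set H) (u v : G × Fin 2) :
    (BCay G (Subtype.val '' S)).Adj u v ↔ (hR.vertexEquiv u).1 = (hR.vertexEquiv v).1 ∧
      (BCay H S).Adj (hR.vertexEquiv u).2 (hR.vertexEquiv v).2 := by
  have h1 : ∀ w, (hR.vertexEquiv w).1 = (hR.equiv w.1).2 := fun _ => rfl
  have h2 : ∀ w, (hR.vertexEquiv w).2 = ((hR.equiv w.1).1, w.2) := fun _ => rfl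
  simp only [BCay_adj, hR.mul_inv_mem_image_iff, h1, h2,
    eq_comm (a := (hR.equiv v.1).2)]
  tauto

/-- An isomorphism of bi-Cayley graphs over a subgroup extends to the ambient group. -/
theorem nonempty_BCay_image_iso {G : Type*} [Group G] {H : Subgroup G} {S T : Set H}
    (f : BCay H S ≃g BCay H T) :
    Nonempty (BCay G (Subtype.val '' S) ≃g BCay G (Subtype.val '' T)) := by
  obtain ⟨R, hR, -⟩ := H.exists_isComplement_right 1
  refine ⟨⟨(hR.vertexEquiv.trans ((Equiv.refl _).prodCongr f.toEquiv)).trans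
    hR.vertexEquiv.symm, ?_⟩⟩
  intro u v
  simp [hR.BCay_image_adj_iff, f.map_adj_iff]

/-- A characteristic subgroup of a finite BCI-group is a BCI-group. -/
theorem characteristic_subgroup_BCIGroup (G : Type*) [Group G] [Finite G]
    (hBCI : IsBCIGroup G) (H : Subgroup G) (hc : H.Characteristic) :
    IsBCIGroup H := by
  rintro S T ⟨f⟩
  obtain ⟨g, α, h⟩ := hBCI _ _ (nonempty_BCay_image_iso f)
  have hα : H.map (α : G →* G) = H := Subgroup.characteristic_iff_map_eq.1 hc α
  let β : H ≃* H := (α.subgroupMap H).trans (MulEquiv.subgroupCongr hα)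
  have hβ : ∀ s : H, ((β s : H) : G) = α s := fun _ => rfl
  rcases S.eq_empty_or_nonempty with rfl | ⟨s, hs⟩
  · exact ⟨1, β, by simpa using h⟩
  have hg : g ∈ H := by
    have hmem : g * α s ∈ Subtype.val '' T := h ▸ ⟨s, ⟨s, hs, rfl⟩, rfl⟩
    obtain ⟨t, -, ht⟩ := hmem
    rw [← hβ] at ht
    exact (H.mul_mem_cancel_right (β s).2).1 (ht ▸ t.2)
  refine ⟨⟨g, hg⟩, β, Subtype.val_injective.image_injective ?_⟩
  rw [h, Set.image_image, Set.image_image]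
  rfl
end

section
/- There is no non-abelian simple 4-BCI-group: if G is a finite non-abelian simple group, then G is not a 4-BCI-group. -/
open SimpleGraph

/-- Exchanging the two parts of the bi-Cayley graph of `S` gives the one of `S⁻¹`. -/
def BCay.isoInv (G : Type*) [Group G] (S : Set G) : BCay G S ≃g BCay G S⁻¹ where
  toEquiv := (Equiv.refl G).prodCongr Fin.revPerm
  map_rel_iff' := by
    rintro ⟨a, i⟩ ⟨b, j⟩
    fin_cases i <;> fin_cases j <;> simp [BCay, SimpleGraph.fromRel_adj, Fin.rev]

/-- In a `4`-BCI-group, the four-element set `{1, x, y, zy}` with `x` and `z` commuting is equivalent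
to its inverse only if one of the three pairs of opposite differences commutes. -/
theorem IsmBCIGroup.commute_or {G : Type*} [Group G] (h : IsmBCIGroup G 4) {x z : G} (y : G)
    (hxz : Commute x z) :
    Commute y (x * z) ∨ Commute y (x⁻¹ * z) ∨ Commute x (y⁻¹ * z * y) := by
  by_contra! hcon
  obtain ⟨h1, h2, h3⟩ := hcon
  have hS : ({1, x, y, z * y} : Set G).ncard ≤ 4 := by
    have e1 := Set.ncard_insert_le (1 : G) {x, y, z * y}
    have e2 := Set.ncard_insert_le x {y, z * y}
    have e3 := Set.ncard_insert_le y {z * y}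
    have e4 := Set.ncard_singleton (z * y)
    omega
  obtain ⟨g, α, hα⟩ := h _ hS _ ⟨BCay.isoInv G _⟩
  have key : ∀ s ∈ ({1, x, y, z * y} : Set G), ∃ t ∈ ({1, x, y, z * y} : Set G),
      g * α t = s⁻¹ := by
    intro s hs
    have : s⁻¹ ∈ ({1, x, y, z * y} : Set G)⁻¹ := Set.inv_mem_inv.mpr hs
    rwa [hα] at this
  obtain ⟨p, hp, ep⟩ := key 1 (by simp)
  obtain ⟨q, hq, eq⟩ := key x (by simp)
  obtain ⟨r, hr, er⟩ := key y (by simp)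
  obtain ⟨s, hs, es⟩ := key (z * y) (by simp)
  have diff : ∀ {a b u v : G}, g * α a = u⁻¹ → g * α b = v⁻¹ → α (a⁻¹ * b) = u * v⁻¹ := by
    intro a b u v ha hb
    rw [← hb, map_mul, map_inv, ← inv_inv u, ← ha]
    group
  have hc : Commute (p⁻¹ * q) (r⁻¹ * s) := by
    refine α.injective ?_
    rw [map_mul _ _ (r⁻¹ * s), map_mul _ (r⁻¹ * s), diff ep eq, diff er es]
    have : Commute x⁻¹ z⁻¹ := hxz.inv_inv
    simpa using this.eq
  have ne : ∀ {a b u v : G}, g * α a = u⁻¹ → g * α b = v⁻¹ → u ≠ v → a ≠ b := by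
    rintro a b u v ha hb huv rfl
    exact huv (inv_injective (ha.symm.trans hb))
  have hx1 : x ≠ 1 := by rintro rfl; exact h3 (Commute.one_left _)
  have hz1 : z ≠ 1 := by rintro rfl; exact h3 (by simp)
  have hy1 : y ≠ 1 := by rintro rfl; exact h1 (Commute.one_left _)
  have hxy : x ≠ y := by
    rintro rfl; exact h1 ((Commute.refl x).mul_right hxz)
  have hzy1 : (1 : G) ≠ z * y := by
    intro e
    obtain rfl : y = z⁻¹ := eq_inv_of_mul_eq_one_right e.symm
    exact h1 ((hxz.symm.mul_right (Commute.refl z)).inv_left)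
  have hxzy : x ≠ z * y := by
    intro e
    obtain rfl : y = z⁻¹ * x := eq_inv_mul_of_mul_eq e.symm
    exact h1 ((hxz.symm.mul_right (Commute.refl z)).inv_left.mul_left
      ((Commute.refl x).mul_right hxz))
  have hyzy : y ≠ z * y := by
    intro e; exact hz1 (by simpa using e.symm)
  have pq := ne ep eq hx1.symm
  have pr := ne ep er hy1.symm
  have ps := ne ep es hzy1
  have qr := ne eq er hxy
  have qs := ne eq es hxzy
  have rs := ne er es hyzy
  have flip : ∀ {a b c : G}, Commute (a⁻¹ * b) c → Commute (b⁻¹ * a) c := by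
    intro a b c k
    simpa using k.inv_left
  have A : ¬ Commute ((1 : G)⁻¹ * x) (y⁻¹ * (z * y)) := by
    simpa [mul_assoc] using h3
  have B : ¬ Commute ((1 : G)⁻¹ * y) (x⁻¹ * (z * y)) := by
    intro k
    refine h2 ?_
    have k' := k.mul_right (by simp : Commute ((1 : G)⁻¹ * y) y⁻¹)
    simpa [mul_assoc] using k'
  have C : ¬ Commute ((1 : G)⁻¹ * (z * y)) (x⁻¹ * y) := by
    intro k
    have k1 := k.mul_left ((Commute.refl (x⁻¹ * y)).inv_left)
    have e : (1 : G)⁻¹ * (z * y) * (x⁻¹ * y)⁻¹ = x * z := by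
      rw [hxz.eq]; group
    rw [e] at k1
    have k2 : Commute (x * z) x := (Commute.refl x).mul_left hxz.symm
    have k3 := k2.mul_right k1
    rw [mul_inv_cancel_left] at k3
    exact h1 k3.symm
  have c1 := flip hc
  have c2 := (flip hc.symm).symm
  have c3 := flip c2
  have c4 := hc.symm
  have c5 := c1.symm
  have c6 := c2.symm
  have c7 := c3.symm
  simp only [Set.mem_insert_iff, Set.mem_singleton_iff] at hp hq hr hs
  clear hα key hS h ne diff ep eq er es
  rcases hp with rfl | rfl | rfl | rfl <;> rcases hq with rfl | rfl | rfl | rfl <;>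
    first
    | contradiction
    | rcases hr with rfl | rfl | rfl | rfl <;>
      first
      | contradiction
      | rcases hs with rfl | rfl | rfl | rfl <;> contradiction

section

variable {G : Type*} [Group G]

theorem IsSimpleGroup.center_eq_bot_of_not_commutative [IsSimpleGroup G]
    (hna : ¬ ∀ a b : G, a * b = b * a) : Subgroup.center G = ⊥ := by
  refine (Subgroup.Normal.eq_bot_or_eq_top inferInstance).resolve_right fun h => hna fun a b => ?_
  have hb : b ∈ Subgroup.center G := h ▸ Subgroup.mem_top b
  exact Subgroup.mem_center_iff.mp hb a

/-- In a non-abelian simple group, no nontrivial element centralizes a nontrivial conjugacy class. -/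
theorem IsSimpleGroup.exists_not_commute_conj [IsSimpleGroup G]
    (hna : ¬ ∀ a b : G, a * b = b * a) {a b : G} (ha : a ≠ 1) (hb : b ≠ 1) :
    ∃ y : G, ¬ Commute b (y⁻¹ * a * y) := by
  by_contra! hcon
  have htop : Subgroup.normalClosure {a} = ⊤ := by
    refine (Subgroup.Normal.eq_bot_or_eq_top inferInstance).resolve_left fun h => ha ?_
    have : a ∈ Subgroup.normalClosure {a} := Subgroup.subset_normalClosure rfl
    rwa [h, Subgroup.mem_bot] at this
  have hle : Subgroup.normalClosure {a} ≤ Subgroup.centralizer {b} := by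
    rw [Subgroup.normalClosure, Subgroup.closure_le]
    intro c hc
    obtain ⟨_, rfl, hc'⟩ := Group.mem_conjugatesOfSet_iff.mp hc
    obtain ⟨y, rfl⟩ := isConj_iff.mp hc'
    rw [SetLike.mem_coe, Subgroup.mem_centralizer_singleton_iff]
    simpa using (hcon y⁻¹).eq.symm
  have hbc : b ∈ Subgroup.center G := by
    refine Subgroup.mem_center_iff.mpr fun c => ?_
    have hc : c ∈ Subgroup.centralizer {b} := hle (htop ▸ Subgroup.mem_top c)
    exact Subgroup.mem_centralizer_singleton_iff.mp hc
  rw [IsSimpleGroup.center_eq_bot_of_not_commutative hna, Subgroup.mem_bot] at hbc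
  exact hb hbc

theorem commute_of_sq_eq_one {a b : G} (ha : a ^ 2 = 1) (hb : b ^ 2 = 1) (hab : (a * b) ^ 2 = 1) :
    Commute a b := by
  have ha' : a⁻¹ = a := inv_eq_of_mul_eq_one_left (by rwa [← sq])
  have hb' : b⁻¹ = b := inv_eq_of_mul_eq_one_left (by rwa [← sq])
  have hab' : (a * b)⁻¹ = a * b := inv_eq_of_mul_eq_one_left (by rwa [← sq])
  rw [mul_inv_rev, ha', hb'] at hab'
  exact hab'.symm

theorem IsmBCIGroup.sq_or_cube_eq_one [IsSimpleGroup G] (hna : ¬ ∀ a b : G, a * b = b * a)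
    (h : IsmBCIGroup G 4) (x : G) : x ^ 2 = 1 ∨ x ^ 3 = 1 := by
  by_contra! hx
  obtain ⟨y, hy⟩ := IsSimpleGroup.exists_not_commute_conj hna hx.1 hx.2
  have hyx : ¬ Commute y (x ^ 3) := by
    intro k
    refine hy ?_
    exact (k.symm.inv_right.mul_right ((Commute.refl x).pow_pow 3 2)).mul_right k.symm
  rcases h.commute_or y ((Commute.refl x).pow_right 2) with k | k | k
  · exact hyx (by rwa [← pow_succ'] at k)
  · refine hyx (Commute.pow_right ?_ 3)
    rwa [sq, inv_mul_cancel_left] at k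
  · exact hy (k.pow_left 3)

theorem IsmBCIGroup.sq_eq_one_of_commute [IsSimpleGroup G] (hna : ¬ ∀ a b : G, a * b = b * a)
    (h : IsmBCIGroup G 4) {w y : G} (hw : w ^ 2 = 1) (hw1 : w ≠ 1) (hwy : Commute w y) :
    y ^ 2 = 1 := by
  refine (h.sq_or_cube_eq_one hna y).elim id fun hy => ?_
  rcases h.sq_or_cube_eq_one hna (w * y) with k | k
  · rwa [hwy.mul_pow, hw, one_mul] at k
  · rw [hwy.mul_pow, hy, mul_one, pow_succ, hw, one_mul] at k
    exact absurd k hw1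

theorem IsmBCIGroup.eq_of_commute_of_sq_eq_one [IsSimpleGroup G]
    (hna : ¬ ∀ a b : G, a * b = b * a) (h : IsmBCIGroup G 4) {x z : G} (hx : x ^ 2 = 1)
    (hx1 : x ≠ 1) (hz : z ^ 2 = 1) (hz1 : z ≠ 1) (hxz : Commute x z) : x = z := by
  by_contra hne
  have hxinv : x⁻¹ = x := inv_eq_of_mul_eq_one_left (by rwa [← sq])
  have hw : (x * z) ^ 2 = 1 := by rw [hxz.mul_pow, hx, hz, one_mul]
  have hw1 : x * z ≠ 1 := fun e => hne (by rw [← hxinv, inv_eq_of_mul_eq_one_right e])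
  have hwz : Commute (x * z) z := hxz.mul_left (Commute.refl z)
  have key : ∀ {a y : G}, a ^ 2 = 1 → a ≠ 1 → Commute a z → Commute y a →
      Commute z (y⁻¹ * z * y) := by
    intro a y ha ha1 haz hya
    have hy := h.sq_eq_one_of_commute hna ha ha1 hya.symm
    have hzy : Commute z y := commute_of_sq_eq_one hz hy
      (h.sq_eq_one_of_commute hna ha ha1 (haz.mul_right hya.symm))
    exact (hzy.inv_right.mul_right (Commute.refl z)).mul_right hzy
  obtain ⟨y, hy⟩ := IsSimpleGroup.exists_not_commute_conj hna hz1 hz1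
  have hyx : ¬ Commute y x := fun k => hy (key hx hx1 hxz k)
  have hyw : ¬ Commute y (x * z) := fun k => hy (key hw hw1 hwz k)
  have k1 : Commute x (y⁻¹ * z * y) := by
    rcases h.commute_or y hxz with k | k | k
    · exact absurd k hyw
    · rw [hxinv] at k
      exact absurd k hyw
    · exact k
  have hwz' : x * z * z = x := by rw [mul_assoc, ← sq, hz, mul_one]
  have hwinv : (x * z)⁻¹ = x * z := inv_eq_of_mul_eq_one_left (by rwa [← sq])
  have k2 : Commute (x * z) (y⁻¹ * z * y) := by
    rcases h.commute_or y hwz with k | k | k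
    · rw [hwz'] at k
      exact absurd k hyx
    · rw [hwinv, hwz'] at k
      exact absurd k hyx
    · exact k
  refine hy ?_
  have k3 := k1.inv_left.mul_left k2
  rwa [inv_mul_cancel_left] at k3

end

/-- There is no non-abelian simple 4-BCI-group. -/
theorem no_nonabelian_simple_four_BCI (G : Type*) [Group G] [Finite G]
    (hs : IsSimpleGroup G) (hna : ¬ ∀ a b : G, a * b = b * a) :
    ¬ IsmBCIGroup G 4 := by
  intro h
  have hcenter := IsSimpleGroup.center_eq_bot_of_not_commutative hna
  have htriv : ∀ p : ℕ, p.Prime → ¬ IsPGroup p G := by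
    intro p hp hG
    have : Fact p.Prime := ⟨hp⟩
    exact hG.bot_lt_center.ne hcenter.symm
  by_cases h2 : 2 ∣ Nat.card G
  · have : Fact (Nat.Prime 2) := ⟨Nat.prime_two⟩
    let P : Sylow 2 G := default
    have hsq : ∀ a ∈ P, a ^ 2 = 1 := by
      intro a ha
      refine (h.sq_or_cube_eq_one hna a).elim id fun h3 => ?_
      obtain ⟨k, hk⟩ := P.2 ⟨a, ha⟩
      have hk' : a ^ 2 ^ k = 1 := congrArg Subtype.val hk
      have hone : orderOf a = 1 := Nat.eq_one_of_dvd_coprimes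
        (Nat.Coprime.pow_right k (by norm_num : Nat.Coprime 3 2))
        (orderOf_dvd_of_pow_eq_one h3) (orderOf_dvd_of_pow_eq_one hk')
      rw [orderOf_eq_one_iff.mp hone, one_pow]
    obtain ⟨t, ht, ht1⟩ := (Subgroup.bot_or_exists_ne_one (P : Subgroup G)).resolve_left
      (P.ne_bot_of_dvd_card h2)
    have hcyc : IsCyclic P := by
      refine ⟨⟨t, ht⟩, fun ⟨a, ha⟩ => ?_⟩
      by_cases ha1 : a = 1
      · exact ⟨0, Subtype.ext (by simp [ha1])⟩
      · refine ⟨1, Subtype.ext ?_⟩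
        simpa using h.eq_of_commute_of_sq_eq_one hna (hsq t ht) ht1 (hsq a ha) ha1
          (commute_of_sq_eq_one (hsq t ht) (hsq a ha) (hsq _ (mul_mem ht ha)))
    have hmin : (Nat.card G).minFac = 2 := (Nat.minFac_eq_two_iff _).mpr h2
    have hcompl := hcyc.isComplement' hmin
    rcases Subgroup.Normal.eq_bot_or_eq_top (MonoidHom.normal_ker
      (MonoidHom.transferSylow P (hcyc.normalizer_le_centralizer hmin))) with hker | hker
    · rw [hker, Subgroup.isComplement'_bot_left] at hcompl
      exact htriv 2 Nat.prime_two fun g => by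
        obtain ⟨k, hk⟩ := P.2 ⟨g, hcompl ▸ Subgroup.mem_top g⟩
        exact ⟨k, congrArg Subtype.val hk⟩
    · rw [hker, Subgroup.isComplement'_top_left] at hcompl
      exact P.ne_bot_of_dvd_card h2 hcompl
  · refine htriv 3 Nat.prime_three fun g => ⟨1, ?_⟩
    refine (h.sq_or_cube_eq_one hna g).elim (fun hg => ?_) fun hg => by rwa [pow_one]
    have hone : orderOf g = 1 := Nat.eq_one_of_dvd_coprimes
      ((Nat.prime_two.coprime_iff_not_dvd).mpr h2) (orderOf_dvd_of_pow_eq_one hg)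
      (orderOf_dvd_natCard g)
    rw [orderOf_eq_one_iff.mp hone, one_pow]
end

section
/- Let p be a prime and k ≥ 1 an integer. The dihedral group D_{2p^k} of order 2p^k is a CI-group if and only if (p ≥ 5 and k = 1) or (p,k) ∈ {(2,1), (3,1), (3,2)}. -/
open SimpleGraph

section CayleyGraph

variable {G : Type*} [Group G]

lemma cay_adj {S : Set G} (h1 : 1 ∉ S) (hS : S⁻¹ = S) (x y : G) :
    (Cay G S).Adj x y ↔ y * x⁻¹ ∈ S := by
  have hsymm : x * y⁻¹ ∈ S ↔ y * x⁻¹ ∈ S := by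
    conv_lhs => rw [← hS, Set.mem_inv]
    simp
  simp only [Cay, SimpleGraph.fromRel_adj, hsymm, or_self, and_iff_right_iff_imp]
  rintro h rfl
  exact h1 (by simpa using h)

/-- Vertex permutations carrying the difference relation of `S` to that of `T` give isomorphisms
of Cayley graphs. -/
def cayIso {S T : Set G} (hS1 : 1 ∉ S) (hS : S⁻¹ = S) (hT1 : 1 ∉ T) (hT : T⁻¹ = T)
    (e : G ≃ G) (he : ∀ x y, e y * (e x)⁻¹ ∈ T ↔ y * x⁻¹ ∈ S) : Cay G S ≃g Cay G T where
  toEquiv := e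
  map_rel_iff' := by
    intro x y
    rw [cay_adj hS1 hS, cay_adj hT1 hT, he]

lemma cay_iso_mem_iff {S T : Set G} (hS1 : 1 ∉ S) (hS : S⁻¹ = S) (hT1 : 1 ∉ T) (hT : T⁻¹ = T)
    (f : Cay G S ≃g Cay G T) (x y : G) : f y * (f x)⁻¹ ∈ T ↔ y * x⁻¹ ∈ S := by
  rw [← cay_adj hS1 hS, ← cay_adj hT1 hT, f.map_adj_iff]

lemma image_eq_of_forall_mem_iff {S T : Set G} (α : G ≃* G) (h : ∀ x, x ∈ S ↔ α x ∈ T) :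
    T = α '' S := by
  ext y
  constructor
  · intro hy
    exact ⟨α.symm y, (h _).2 (by simpa using hy), by simp⟩
  · rintro ⟨x, hx, rfl⟩
    exact (h x).1 hx

end CayleyGraph

namespace DihedralGroup

/-- The automorphism `aⁱ ↦ a^(ui)`, `b aⁱ ↦ b a^(ui + c)` of the dihedral group. -/
def affineAut {n : ℕ} (u : (ZMod n)ˣ) (c : ZMod n) : DihedralGroup n ≃* DihedralGroup n where
  toFun
    | r i => r (u * i)
    | sr i => sr (u * i + c)
  invFun
    | r i => r ((u⁻¹ : (ZMod n)ˣ) * i)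
    | sr i => sr ((u⁻¹ : (ZMod n)ˣ) * (i - c))
  left_inv := by rintro (i | i) <;> simp
  right_inv := by rintro (i | i) <;> simp
  map_mul' := by rintro (i | i) (j | j) <;> simp <;> ring

@[simp] lemma affineAut_r {n : ℕ} (u : (ZMod n)ˣ) (c i : ZMod n) :
    affineAut u c (r i) = r ((u : ZMod n) * i) := rfl

@[simp] lemma affineAut_sr {n : ℕ} (u : (ZMod n)ˣ) (c i : ZMod n) :
    affineAut u c (sr i) = sr ((u : ZMod n) * i + c) := rfl

/-- For `n ≥ 3`, every automorphism preserves the rotation subgroup and acts on it by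
multiplication by a constant. -/
lemma exists_forall_apply_r_eq {n : ℕ} (hn : 3 ≤ n) (α : DihedralGroup n ≃* DihedralGroup n) :
    ∃ u : ZMod n, ∀ i, α (r i) = r (u * i) := by
  have : NeZero n := ⟨by omega⟩
  obtain ⟨u, hu⟩ : ∃ u, α (r 1) = r u := by
    cases h : α (r 1) with
    | r u => exact ⟨u, rfl⟩
    | sr u =>
      have h1 : orderOf (α (r 1)) = n := by rw [MulEquiv.orderOf_eq, orderOf_r_one]
      rw [h, orderOf_sr] at h1
      omega
  refine ⟨u, fun i => ?_⟩
  have hi : r i = (r 1 : DihedralGroup n) ^ i.val := by simp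
  rw [hi, map_pow, hu, r_pow, ZMod.natCast_zmod_val]

end DihedralGroup

section NotCI

open DihedralGroup

/-- Two fixed-point-free involutive permutations of a finite type are conjugate. -/
lemma isConj_of_involutive_of_ne {V : Type*} [Finite V] {σ τ : Equiv.Perm V}
    (hσ : ∀ x, σ (σ x) = x) (hτ : ∀ x, τ (τ x) = x) (hσ' : ∀ x, σ x ≠ x) (hτ' : ∀ x, τ x ≠ x) :
    IsConj σ τ := by
  classical
  have := Fintype.ofFinite V
  have key : ∀ ρ : Equiv.Perm V, (∀ x, ρ (ρ x) = x) → (∀ x, ρ x ≠ x) →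
      ∃ m, ρ.cycleType = Multiset.replicate m 2 ∧ m * 2 = Fintype.card V := by
    intro ρ h h'
    have h2 : ρ ^ 2 = 1 := by ext x; simp [pow_two, h]
    have h3 := Equiv.Perm.cycleType_of_pow_prime_eq_one h2
    refine ⟨_, h3, ?_⟩
    have h4 := ρ.sum_cycleType
    rw [h3, Multiset.sum_replicate, smul_eq_mul] at h4
    rw [h4, ← Finset.card_univ]
    congr 1
    ext x
    simp [h']
  obtain ⟨m, hm, hm'⟩ := key σ hσ hσ'
  obtain ⟨l, hl, hl'⟩ := key τ hτ hτ'
  rw [Equiv.Perm.isConj_iff_cycleType_eq, hm, hl]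
  congr 1
  omega

lemma not_isCIGroup_dihedralGroup_of_even {m : ℕ} (hm : 2 ≤ m) :
    ¬ IsCIGroup (DihedralGroup (2 * m)) := by
  intro hCI
  have : NeZero (2 * m) := ⟨by omega⟩
  have hm0 : ((m : ZMod (2 * m))) ≠ 0 := by
    rw [Ne, ZMod.natCast_eq_zero_iff]
    intro h
    have := Nat.le_of_dvd (by omega) h
    omega
  have hmm : (m : ZMod (2 * m)) + m = 0 := by
    have : ((2 * m : ℕ) : ZMod (2 * m)) = 0 := ZMod.natCast_self _
    rw [← this]; push_cast; ring
  set s : DihedralGroup (2 * m) := r m with hs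
  set t : DihedralGroup (2 * m) := sr 0 with ht
  have hs1 : s ≠ 1 := fun h => hm0 (r.inj (h : r _ = r 0))
  have ht1 : t ≠ 1 := fun h => DihedralGroup.noConfusion rfl (heq_of_eq (h : sr 0 = r 0))
  have hss : s * s = 1 := by rw [hs, r_mul_r, hmm]; rfl
  have htt : t * t = 1 := by rw [ht, sr_mul_sr, sub_zero]; rfl
  have hS1 : (1 : DihedralGroup (2 * m)) ∉ ({s} : Set _) := fun h => hs1 h.symm
  have hT1 : (1 : DihedralGroup (2 * m)) ∉ ({t} : Set _) := fun h => ht1 h.symm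
  have hS : ({s} : Set (DihedralGroup (2 * m)))⁻¹ = {s} := by
    rw [Set.inv_singleton, inv_eq_of_mul_eq_one_right hss]
  have hT : ({t} : Set (DihedralGroup (2 * m)))⁻¹ = {t} := by
    rw [Set.inv_singleton, inv_eq_of_mul_eq_one_right htt]
  obtain ⟨g, hg⟩ := isConj_iff.1 (isConj_of_involutive_of_ne
    (σ := Equiv.mulLeft s) (τ := Equiv.mulLeft t)
    (fun x => by simp [← mul_assoc, hss]) (fun x => by simp [← mul_assoc, htt])
    (fun x => by simpa using hs1) (fun x => by simpa using ht1))
  have hg' : ∀ x, g (s * x) = t * g x := by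
    intro x
    have := congrArg (fun ρ => ρ (g x)) hg
    simpa using this
  obtain ⟨α, hα⟩ := hCI {s} hS1 hS {t} hT1 hT ⟨cayIso hS1 hS hT1 hT g fun x y => by
    rw [Set.mem_singleton_iff, Set.mem_singleton_iff, mul_inv_eq_iff_eq_mul,
      mul_inv_eq_iff_eq_mul, ← hg', g.injective.eq_iff]⟩
  obtain ⟨u, hu⟩ := exists_forall_apply_r_eq (by omega) α
  rw [Set.image_singleton, hs, hu, Set.singleton_eq_singleton_iff, ht] at hα
  cases hα

end NotCI

section OddPrimePower

open DihedralGroup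

/-- The permutation of `ℤ/p^(j+2)` used to twist circulant graphs: it adds `p^(j+1) * ⌊x/p⌋`. -/
def twist (p j : ℕ) (x : ZMod (p ^ (j + 2))) : ZMod (p ^ (j + 2)) :=
  x + (p : ZMod (p ^ (j + 2))) ^ (j + 1) * ((x.val / p : ℕ) : ZMod (p ^ (j + 2)))

variable {p j : ℕ}

lemma prime_pow_eq_zero_of_le {i : ℕ} (hi : j + 2 ≤ i) :
    (p : ZMod (p ^ (j + 2))) ^ i = 0 := by
  rw [← Nat.cast_pow, ZMod.natCast_eq_zero_iff]
  exact pow_dvd_pow p hi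

lemma twist_add_prime (hp : p.Prime) (y : ZMod (p ^ (j + 2))) :
    twist p j (y + p) = twist p j y + (1 + (p : ZMod (p ^ (j + 2))) ^ j) * p := by
  have hN : NeZero (p ^ (j + 2)) := ⟨(pow_pos hp.pos _).ne'⟩
  have hlt : p < p ^ (j + 2) := by
    calc p = p ^ 1 := (pow_one p).symm
      _ < p ^ (j + 2) := Nat.pow_lt_pow_right hp.one_lt (by omega)
  have hval : (y + (p : ZMod (p ^ (j + 2)))).val = (y.val + p) % p ^ (j + 2) := by
    rw [ZMod.val_add, ZMod.val_natCast, Nat.mod_eq_of_lt hlt]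
  obtain ⟨e, he⟩ : ∃ e, y.val + p = (y.val + p) % p ^ (j + 2) + p * (p ^ (j + 1) * e) := by
    refine ⟨(y.val + p) / p ^ (j + 2), ?_⟩
    conv_lhs => rw [← Nat.mod_add_div (y.val + p) (p ^ (j + 2))]
    ring
  have hdiv : y.val / p + 1 = (y.val + p) % p ^ (j + 2) / p + p ^ (j + 1) * e := by
    rw [← Nat.add_div_right _ hp.pos, ← Nat.add_mul_div_left _ _ hp.pos, ← he]
  have hc := congrArg (Nat.cast : ℕ → ZMod (p ^ (j + 2))) hdiv
  push_cast at hc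
  have h0 : (p : ZMod (p ^ (j + 2))) ^ (j + 1) * p ^ (j + 1) = 0 := by
    rw [← pow_add]
    exact prime_pow_eq_zero_of_le (by omega)
  simp only [twist, hval]
  linear_combination (-(p : ZMod (p ^ (j + 2))) ^ (j + 1)) * hc - e * h0

lemma twist_add_mul_prime (hp : p.Prime) (y : ZMod (p ^ (j + 2))) (s : ℕ) :
    twist p j (y + p * s) = twist p j y + (1 + (p : ZMod (p ^ (j + 2))) ^ j) * p * s := by
  induction s with
  | zero => simp
  | succ s ih =>
    have h := twist_add_prime (j := j) hp (y + p * s)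
    push_cast
    rw [show y + (p : ZMod (p ^ (j + 2))) * (s + 1) = y + p * s + p by ring, h, ih]
    ring

lemma prime_mul_twist (x : ZMod (p ^ (j + 2))) :
    (p : ZMod (p ^ (j + 2))) * twist p j x = p * x := by
  have h0 : (p : ZMod (p ^ (j + 2))) ^ (j + 2) = 0 := prime_pow_eq_zero_of_le le_rfl
  rw [twist]
  linear_combination ((x.val / p : ℕ) : ZMod (p ^ (j + 2))) * h0

lemma isUnit_one_add_prime_pow (hp : p.Prime) (h2 : p ≠ 2) :
    IsUnit (1 + (p : ZMod (p ^ (j + 2))) ^ j) := by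
  have : 1 + (p : ZMod (p ^ (j + 2))) ^ j = ((1 + p ^ j : ℕ) : ZMod (p ^ (j + 2))) := by
    push_cast; rfl
  rw [this, ZMod.isUnit_iff_coprime]
  apply Nat.Coprime.pow_right
  rw [Nat.coprime_comm, hp.coprime_iff_not_dvd]
  intro h
  rcases Nat.eq_zero_or_pos j with rfl | hj
  · have := Nat.le_of_dvd (by norm_num) h
    have := hp.two_le
    rw [pow_zero] at *
    omega
  · have := (Nat.dvd_add_left (dvd_pow_self p hj.ne')).1 h
    exact hp.one_lt.ne' (Nat.dvd_one.1 this)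

lemma isUnit_two_add_prime_pow (hp : p.Prime) (h2 : p ≠ 2) (h3 : ¬ (p = 3 ∧ j = 0)) :
    IsUnit (2 + (p : ZMod (p ^ (j + 2))) ^ j) := by
  have : 2 + (p : ZMod (p ^ (j + 2))) ^ j = ((2 + p ^ j : ℕ) : ZMod (p ^ (j + 2))) := by
    push_cast; rfl
  rw [this, ZMod.isUnit_iff_coprime]
  apply Nat.Coprime.pow_right
  rw [Nat.coprime_comm, hp.coprime_iff_not_dvd]
  intro h
  rcases Nat.eq_zero_or_pos j with rfl | hj
  · exact h3 ⟨(Nat.prime_dvd_prime_iff_eq hp Nat.prime_three).1 h, rfl⟩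
  · have := (Nat.dvd_add_left (dvd_pow_self p hj.ne')).1 h
    exact h2 ((Nat.prime_dvd_prime_iff_eq hp Nat.prime_two).1 this)

lemma twist_injective (hp : p.Prime) (h2 : p ≠ 2) : Function.Injective (twist p j) := by
  intro x y hxy
  have hN : NeZero (p ^ (j + 2)) := ⟨(pow_pos hp.pos _).ne'⟩
  have h1 : (p : ZMod (p ^ (j + 2))) * (x - y) = 0 := by
    have hx := prime_mul_twist (j := j) x
    have hy := prime_mul_twist (j := j) y
    rw [hxy] at hx
    linear_combination hy - hx
  obtain ⟨t, ht⟩ : ∃ t : ℕ, x = y + p * (t : ℕ) := by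
    have h3 : ((p * (x - y).val : ℕ) : ZMod (p ^ (j + 2))) = 0 := by
      push_cast
      rw [ZMod.natCast_zmod_val, h1]
    rw [ZMod.natCast_eq_zero_iff] at h3
    have h4 : p * p ^ (j + 1) ∣ p * (x - y).val := (pow_succ' p (j + 1)).symm.dvd.trans h3
    obtain ⟨t, ht⟩ := (dvd_pow_self p (Nat.succ_ne_zero j)).trans
      (Nat.dvd_of_mul_dvd_mul_left hp.pos h4)
    refine ⟨t, ?_⟩
    have := congrArg (Nat.cast : ℕ → ZMod (p ^ (j + 2))) ht
    rw [ZMod.natCast_zmod_val] at this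
    push_cast at this
    linear_combination this
  rw [ht, twist_add_mul_prime hp, add_eq_left, mul_assoc,
    (isUnit_one_add_prime_pow hp h2).mul_right_eq_zero] at hxy
  rw [ht, hxy, add_zero]

/-- The rotations `aˣ` with `p x ≡ ± p` or `x ≡ ± c`. -/
def twistSet (p j : ℕ) (c : ZMod (p ^ (j + 2))) : Set (DihedralGroup (p ^ (j + 2))) :=
  r '' {x | p * x = p ∨ p * x = -p ∨ x = c ∨ x = -c}

lemma r_mem_twistSet {c x : ZMod (p ^ (j + 2))} :
    r x ∈ twistSet p j c ↔ p * x = p ∨ p * x = -p ∨ x = c ∨ x = -c := by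
  simp [twistSet]

lemma sr_notMem_twistSet {c x : ZMod (p ^ (j + 2))} : sr x ∉ twistSet p j c := by
  simp [twistSet]

lemma twistSet_inv (c : ZMod (p ^ (j + 2))) : (twistSet p j c)⁻¹ = twistSet p j c := by
  ext (x | x)
  · rw [Set.mem_inv, inv_r, r_mem_twistSet, r_mem_twistSet, mul_neg, neg_inj, neg_inj,
      neg_eq_iff_eq_neg, neg_eq_iff_eq_neg]
    tauto
  · simp [sr_notMem_twistSet]

lemma not_prime_pow_dvd {i : ℕ} (hp : p.Prime) (hi : i < j + 2) :
    (p : ZMod (p ^ (j + 2))) ^ i ≠ 0 := by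
  rw [← Nat.cast_pow, Ne, ZMod.natCast_eq_zero_iff, Nat.pow_dvd_pow_iff_le_right hp.one_lt]
  omega

lemma one_notMem_twistSet (hp : p.Prime) {c : ZMod (p ^ (j + 2))} (hc : c ≠ 0) :
    1 ∉ twistSet p j c := by
  have h0 : (p : ZMod (p ^ (j + 2))) ≠ 0 := by
    simpa using not_prime_pow_dvd (i := 1) (j := j) hp (by omega)
  rw [one_def, r_mem_twistSet]
  simp [eq_comm, h0, hc]

lemma twist_sub_mem_iff (hp : p.Prime) (h2 : p ≠ 2) (x y : ZMod (p ^ (j + 2))) :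
    r (twist p j y - twist p j x) ∈ twistSet p j ((1 + (p : ZMod (p ^ (j + 2))) ^ j) * p) ↔
      r (y - x) ∈ twistSet p j p := by
  have hsub : ∀ x y : ZMod (p ^ (j + 2)),
      twist p j y - twist p j x = (1 + (p : ZMod (p ^ (j + 2))) ^ j) * p ↔ y - x = p := by
    intro x y
    rw [sub_eq_iff_eq_add', ← twist_add_prime hp, (twist_injective hp h2).eq_iff,
      sub_eq_iff_eq_add']
  have hneg : ∀ a b c : ZMod (p ^ (j + 2)), a - b = -c ↔ b - a = c := by
    intro a b c
    rw [← neg_inj, neg_sub, neg_neg]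
  rw [r_mem_twistSet, r_mem_twistSet, hsub, hneg _ _ (_ * _), hsub, hneg, mul_sub, mul_sub,
    prime_mul_twist, prime_mul_twist]

lemma not_isCIGroup_dihedralGroup_odd_prime_pow (hp : p.Prime) (h2 : p ≠ 2)
    (h3 : ¬ (p = 3 ∧ j = 0)) : ¬ IsCIGroup (DihedralGroup (p ^ (j + 2))) := by
  intro hCI
  have hN : NeZero (p ^ (j + 2)) := ⟨(pow_pos hp.pos _).ne'⟩
  have hp3 : 3 ≤ p := lt_of_le_of_ne hp.two_le h2.symm
  have hN3 : 3 ≤ p ^ (j + 2) := hp3.trans (Nat.le_self_pow (by omega) p)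
  have hunit := isUnit_one_add_prime_pow (j := j) hp h2
  set P := (p : ZMod (p ^ (j + 2))) with hP
  have hP1 : P ≠ 0 := by simpa using not_prime_pow_dvd (i := 1) (j := j) hp (by omega)
  have hc : (1 + P ^ j) * P ≠ 0 := by rwa [Ne, hunit.mul_right_eq_zero]
  obtain ⟨α, hα⟩ := hCI _ (one_notMem_twistSet hp hP1) (twistSet_inv _) _
    (one_notMem_twistSet hp hc) (twistSet_inv _) ⟨cayIso (one_notMem_twistSet hp hP1)
      (twistSet_inv _) (one_notMem_twistSet hp hc) (twistSet_inv _)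
      (Equiv.ofBijective (fun | r i => r (twist p j i) | sr i => sr (twist p j i))
        (Finite.injective_iff_bijective.1 (by
          rintro (x | x) (y | y) h
          all_goals simp at h
          all_goals rw [twist_injective hp h2 h])))
      (by
        have key := twist_sub_mem_iff (j := j) hp h2
        rintro (x | x) (y | y)
        · simpa [← sub_eq_add_neg] using key x y
        · simp [sr_notMem_twistSet]
        · simp [sr_notMem_twistSet]
        · simpa using key y x)⟩
  obtain ⟨u, hu⟩ := exists_forall_apply_r_eq hN3 α
  have hmem : ∀ x, r x ∈ twistSet p j P → r (u * x) ∈ twistSet p j ((1 + P ^ j) * P) := by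
    intro x hx
    rw [hα, ← hu]
    exact Set.mem_image_of_mem _ hx
  have hu1 := r_mem_twistSet.1 (hmem 1 (r_mem_twistSet.2 (Or.inl (mul_one _))))
  have hu2 := r_mem_twistSet.1 (hmem P (r_mem_twistSet.2 (Or.inr (Or.inr (Or.inl rfl)))))
  rw [mul_one] at hu1
  rw [← hP] at hu1 hu2
  have hpow : P ^ (j + 2) = 0 := prime_pow_eq_zero_of_le le_rfl
  have hpow' : P ^ (j + 1) ≠ 0 := not_prime_pow_dvd hp (by omega)
  have hcancel : (1 + P ^ j) * P ^ (j + 1) ≠ 0 := by rwa [Ne, hunit.mul_right_eq_zero]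
  have hcancel' : (2 + P ^ j) * P ≠ 0 := by
    rwa [Ne, (isUnit_two_add_prime_pow hp h2 h3).mul_right_eq_zero]
  rcases hu2 with h | h | h | h
  · exact hpow' (by linear_combination u * hpow - P ^ j * h)
  · exact hpow' (by linear_combination P ^ j * h - u * hpow)
  · rcases hu1 with h' | h' | h' | h'
    · exact hpow' (by linear_combination h' - h)
    · exact hcancel' (by linear_combination h' - h)
    · exact hcancel (by linear_combination (1 + P ^ j) * hpow - P ^ j * h + P ^ (j + 1) * h')
    · exact hcancel (by linear_combination -(1 + P ^ j) * hpow - P ^ j * h + P ^ (j + 1) * h')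
  · rcases hu1 with h' | h' | h' | h'
    · exact hcancel' (by linear_combination h - h')
    · exact hpow' (by linear_combination h - h')
    · exact hcancel (by linear_combination -(1 + P ^ j) * hpow + P ^ j * h - P ^ (j + 1) * h')
    · exact hcancel (by linear_combination (1 + P ^ j) * hpow + P ^ j * h - P ^ (j + 1) * h')

end OddPrimePower

section KleinFour

lemma isCIGroup_of_isKleinFour (G : Type*) [Group G] [IsKleinFour G] : IsCIGroup G := by
  classical
  intro S hS1 hS T hT1 hT ⟨f⟩
  have : Finite G := Nat.finite_of_card_ne_zero (by rw [IsKleinFour.card_four]; norm_num)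
  have := Fintype.ofFinite G
  have e : {x // x ∈ S} ≃ {x // x ∈ T} := Equiv.ofBijective
    (fun x => ⟨f x * (f 1)⁻¹, (cay_iso_mem_iff hS1 hS hT1 hT f 1 x).2 (by simp)⟩) <| by
      refine ⟨fun x y h => Subtype.ext ?_, fun y => ?_⟩
      · simpa using h
      · refine ⟨⟨f.symm (y * f 1), ?_⟩, by simp⟩
        have := cay_iso_mem_iff hS1 hS hT1 hT f 1 (f.symm (y * f 1))
        simpa using this.1 (by simp)
  have hmem : ∀ x, x ∈ S ↔ e.extendSubtype x ∈ T := fun x =>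
    ⟨e.extendSubtype_mem x, fun h => by_contra fun hx => e.extendSubtype_not_mem x hx h⟩
  refine ⟨IsKleinFour.mulEquiv'
    (e.extendSubtype.trans (Equiv.swap (e.extendSubtype 1) 1)) (by simp)
    IsKleinFour.exponent_two, image_eq_of_forall_mem_iff _ fun x => ?_⟩
  have h1 : e.extendSubtype 1 ∉ T := mt (hmem 1).2 hS1
  rw [hmem x]
  change _ ↔ Equiv.swap (e.extendSubtype 1) 1 (e.extendSubtype x) ∈ T
  rw [Equiv.swap_apply_def]
  split_ifs with h h'
  · simp [h, h1, hT1]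
  · simp [h', h1, hT1]
  · rfl

end KleinFour

section SylowConjugation

/-- The group of vertex permutations preserving the difference relation of `T`. -/
def cayAut {G : Type*} [Group G] (T : Set G) : Subgroup (Equiv.Perm G) where
  carrier := {σ | ∀ x y, σ y * (σ x)⁻¹ ∈ T ↔ y * x⁻¹ ∈ T}
  one_mem' := by simp
  mul_mem' := by
    intro σ τ hσ hτ x y
    rw [Equiv.Perm.mul_apply, Equiv.Perm.mul_apply, hσ, hτ]
  inv_mem' := by
    intro σ hσ x y
    rw [← hσ]
    simp

/-- If the Sylow `p`-subgroups of a symmetric group are so small that they are commutative, then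
any two elements of `p`-power order in a permutation group commute after conjugating one of
them. -/
lemma exists_conj_commute {V : Type*} [Finite V] {p : ℕ} (hp : p.Prime)
    (hV : ¬ p ^ 3 ∣ (Nat.card V).factorial) (A : Subgroup (Equiv.Perm V)) {z y : Equiv.Perm V}
    (hz : z ∈ A) (hy : y ∈ A) (hzp : z ^ p = 1) (hyp : y ^ p = 1) :
    ∃ a ∈ A, Commute (a * y * a⁻¹) z := by
  have := Fact.mk hp
  have hP : ∀ w : A, w ^ p = 1 → ∃ P : Sylow p A, w ∈ P := by
    intro w hw
    have h : IsPGroup p (Subgroup.zpowers w) := by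
      apply IsPGroup.of_card (n := (Nat.card (Subgroup.zpowers w)).factorization p)
      have h1 : Nat.card (Subgroup.zpowers w) ∣ p := by
        rw [Nat.card_zpowers]
        exact orderOf_dvd_of_pow_eq_one hw
      rcases (Nat.dvd_prime hp).1 h1 with h | h <;> simp [h, hp.factorization]
    obtain ⟨P, hP⟩ := h.exists_le_sylow
    exact ⟨P, hP (Subgroup.mem_zpowers w)⟩
  obtain ⟨P, hzP⟩ := hP ⟨z, hz⟩ (Subtype.ext (by simpa using hzp))
  obtain ⟨Q, hyQ⟩ := hP ⟨y, hy⟩ (Subtype.ext (by simpa using hyp))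
  obtain ⟨a, ha⟩ := MulAction.exists_smul_eq A Q P
  have hyP : a * ⟨y, hy⟩ * a⁻¹ ∈ P := by
    rw [← ha]
    exact Subgroup.smul_mem_pointwise_smul _ (MulAut.conj a) _ hyQ
  have hcomm : ∀ s ∈ P, ∀ t ∈ P, s * t = t * s := by
    obtain ⟨n, hn⟩ := P.isPGroup'.exists_card_eq
    have hdvd : p ^ n ∣ (Nat.card V).factorial := by
      rw [← hn, ← Nat.card_perm]
      exact (Subgroup.card_subgroup_dvd_card _).trans (Subgroup.card_subgroup_dvd_card _)
    have hn3 : n < 3 := by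
      by_contra! h
      exact hV ((pow_dvd_pow p h).trans hdvd)
    have hPc : IsMulCommutative P := by
      interval_cases n
      · have : Subsingleton P := (Nat.card_eq_one_iff_unique.1 hn).1
        exact ⟨⟨fun _ _ => Subsingleton.elim _ _⟩⟩
      · have : IsCyclic P := isCyclic_of_prime_card (hn.trans (pow_one p))
        exact inferInstance
      · exact IsPGroup.isMulCommutative_of_card_eq_prime_sq hn
    intro s hs t ht
    exact congrArg Subtype.val (hPc.is_comm.comm ⟨s, hs⟩ ⟨t, ht⟩)
  refine ⟨a, a.2, ?_⟩
  have := hcomm _ hyP _ hzP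
  exact congrArg Subtype.val this

end SylowConjugation

section DihedralPrime

open DihedralGroup

lemma not_cube_dvd_factorial_two_mul {p : ℕ} (hp : p.Prime) (h2 : p ≠ 2) :
    ¬ p ^ 3 ∣ (2 * p).factorial := by
  have := Fact.mk hp
  rw [padicValNat_dvd_iff_le (Nat.factorial_ne_zero _), mul_comm, padicValNat_factorial_mul]
  have : padicValNat p (Nat.factorial 2) = 0 := by
    apply padicValNat.eq_zero_of_not_dvd
    rw [hp.dvd_factorial]
    have := hp.two_le
    omega
  omega

/-- A permutation of odd order commuting with right translation by `a` translates the rotations. -/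
lemma exists_eq_add_of_commute_mulRight {n m : ℕ} [NeZero n] (hm : Odd m)
    {y : Equiv.Perm (DihedralGroup n)} (hy : Commute y (Equiv.mulRight (r 1)))
    (hym : y ^ m = 1) : ∃ a, ∀ i, y (r i) = r (a + i) := by
  have h1 : ∀ x, y (x * r 1) = y x * r 1 := fun x => congrArg (fun σ => σ x) hy.eq
  have hpow : ∀ (l : ℕ) x, y (x * r 1 ^ l) = y x * r 1 ^ l := by
    intro l
    induction l with
    | zero => simp
    | succ l ih => intro x; rw [pow_succ, ← mul_assoc, h1, ih, mul_assoc]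
  have hr : ∀ i : ZMod n, r 1 ^ i.val = (r i : DihedralGroup n) := by simp
  have hr0 : ∀ i, y (r i) = y (r 0) * r i := by
    intro i
    have := hpow i.val (r 0)
    rwa [hr, r_mul_r, zero_add] at this
  have hsr0 : ∀ i, y (sr i) = y (sr 0) * r i := by
    intro i
    have := hpow i.val (sr 0)
    rwa [hr, sr_mul_r, zero_add] at this
  cases ha : y (r 0) with
  | r a => exact ⟨a, fun i => by rw [hr0, ha, r_mul_r]⟩
  | sr a =>
    exfalso
    cases hb : y (sr 0) with
    | r b =>
      have heven : ∀ l : ℕ, ∃ c, (y ^ (2 * l)) (r 0) = r c := by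
        intro l
        induction l with
        | zero => exact ⟨0, rfl⟩
        | succ l ih =>
          obtain ⟨c, hc⟩ := ih
          refine ⟨b + (a + c), ?_⟩
          rw [show 2 * (l + 1) = 2 * l + 1 + 1 by ring, pow_succ', pow_succ',
            Equiv.Perm.mul_apply, Equiv.Perm.mul_apply, hc, hr0, ha, sr_mul_r, hsr0, hb, r_mul_r]
      obtain ⟨l, rfl⟩ := hm
      obtain ⟨c, hc⟩ := heven l
      have h : (y ^ (2 * l + 1)) (r 0) = sr (a + c) := by
        rw [pow_succ', Equiv.Perm.mul_apply, hc, hr0, ha, sr_mul_r]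
      rw [hym] at h
      cases h
    | sr b =>
      have h := y.injective (a₁ := r (b - a)) (a₂ := sr 0) (by rw [hr0, ha, hb]; simp)
      cases h

/-- Conjugating by a right translation preserves commutation with right translation by `a`. -/
lemma commute_conj_mulRight {n : ℕ} {y : Equiv.Perm (DihedralGroup n)}
    (hy : Commute y (Equiv.mulRight (r 1))) (w : DihedralGroup n) :
    Commute (Equiv.mulRight w * y * (Equiv.mulRight w)⁻¹) (Equiv.mulRight (r 1)) := by
  have key : ∃ v : Equiv.Perm (DihedralGroup n), Commute y v ∧
      Equiv.mulRight (r 1) = Equiv.mulRight w * v * (Equiv.mulRight w)⁻¹ := by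
    cases w with
    | r i => exact ⟨Equiv.mulRight (r 1), hy, by ext x; simp [mul_assoc, add_comm]⟩
    | sr i => exact ⟨(Equiv.mulRight (r 1))⁻¹, hy.inv_right, by ext x; simp [mul_assoc]⟩
  obtain ⟨v, hv, h⟩ := key
  rw [h]
  simp only [Commute, SemiconjBy, mul_assoc, inv_mul_cancel_left, mul_right_inj]
  rw [← mul_assoc, hv.eq, mul_assoc]

lemma mulRight_mem_cayAut {G : Type*} [Group G] (T : Set G) (g : G) :
    Equiv.mulRight g ∈ cayAut T := by
  intro x y
  simp

lemma isCIGroup_dihedralGroup_odd_prime {p : ℕ} (hp : p.Prime) (h2 : p ≠ 2) :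
    IsCIGroup (DihedralGroup p) := by
  intro S hS1 hS T hT1 hT ⟨f⟩
  have := Fact.mk hp
  set z : Equiv.Perm (DihedralGroup p) := Equiv.mulRight (r 1) with hz
  have hzapp : ∀ x, z x = x * r 1 := fun _ => rfl
  have hzp : z ^ p = 1 := by
    rw [hz, Equiv.pow_mulRight]
    simp
  obtain ⟨F, hF⟩ : ∃ F : Equiv.Perm (DihedralGroup p), ∀ x y, F y * (F x)⁻¹ ∈ T ↔ y * x⁻¹ ∈ S :=
    ⟨f.toEquiv, cay_iso_mem_iff hS1 hS hT1 hT f⟩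
  have hconj : ∀ σ : Equiv.Perm (DihedralGroup p), (σ * z * σ⁻¹) ^ p = 1 := by
    intro σ
    rw [conj_pow, hzp, mul_one, mul_inv_cancel]
  have hyA : F * z * F⁻¹ ∈ cayAut T := by
    intro x y
    have h := hF (F⁻¹ x) (F⁻¹ y)
    rw [Equiv.Perm.inv_def, F.apply_symm_apply, F.apply_symm_apply] at h
    simp only [Equiv.Perm.mul_apply, Equiv.Perm.inv_def, hF, h, hzapp,
      mul_inv_rev, ← mul_assoc, mul_inv_cancel_right]
  obtain ⟨σ, hσ, hcomm⟩ := exists_conj_commute hp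
    (by rw [nat_card]; exact not_cube_dvd_factorial_two_mul hp h2) (cayAut T)
    (mulRight_mem_cayAut T (r 1)) hyA hzp (hconj F)
  set w := (σ (F 1))⁻¹ with hw
  set g := Equiv.mulRight w * (σ * F) with hg
  have hg1 : g (r 0) = r 0 := mul_inv_cancel (σ (F 1))
  have hgT : ∀ x y, g y * (g x)⁻¹ ∈ T ↔ y * x⁻¹ ∈ S := fun x y =>
    (mulRight_mem_cayAut T w (σ (F x)) (σ (F y))).trans ((hσ (F x) (F y)).trans (hF x y))
  have hgz : g * z * g⁻¹ = Equiv.mulRight w * (σ * (F * z * F⁻¹) * σ⁻¹) * (Equiv.mulRight w)⁻¹ := by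
    rw [hg]
    group
  obtain ⟨a, ha⟩ := exists_eq_add_of_commute_mulRight (hp.odd_of_ne_two h2)
    (hgz ▸ commute_conj_mulRight hcomm w) (hconj g)
  have hgr : ∀ i, g (r i) = r (a * i) := by
    have hnat : ∀ l : ℕ, g (r (l : ZMod p)) = r (a * (l : ZMod p)) := by
      intro l
      induction l with
      | zero => simpa using hg1
      | succ l ih =>
        have h := ha (a * l)
        rw [← ih, Equiv.Perm.mul_apply, Equiv.Perm.mul_apply, Equiv.Perm.inv_def, g.symm_apply_apply, hzapp,
          r_mul_r] at h
        rw [Nat.cast_succ, h]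
        congr 1
        ring
    intro i
    rw [← ZMod.natCast_zmod_val i, hnat]
  have ha0 : a ≠ 0 := by
    rintro rfl
    have := g.injective (a₁ := r 1) (a₂ := r 0) (by rw [hgr, hgr, zero_mul, zero_mul])
    exact one_ne_zero (r.inj this)
  obtain ⟨c, hc⟩ : ∃ c, g (sr 0) = sr c := by
    cases h : g (sr 0) with
    | sr c => exact ⟨c, rfl⟩
    | r c =>
      have := g.injective (a₁ := r (a⁻¹ * c)) (a₂ := sr 0) (by
        rw [hgr, h, mul_inv_cancel_left₀ ha0])
      cases this
  refine ⟨affineAut (Units.mk0 a ha0) c, image_eq_of_forall_mem_iff _ ?_⟩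
  rintro (i | i)
  · have h := hgT (r 0) (r i)
    rw [hg1, hgr] at h
    simpa using h.symm
  · have h := hgT (r (-i)) (sr 0)
    rw [hc, hgr] at h
    simpa [add_comm] using h.symm

end DihedralPrime

section Convolution

variable {G : Type*} [Group G] [Fintype G]

/-- The convolution square of a weight function on a group. -/
def convSq (f : G → ℕ) (g : G) : ℕ := ∑ h, f h * f (g * h⁻¹)

lemma convSq_apply_eq_of_equiv {f f' : G → ℕ} (φ : G ≃ G)
    (h : ∀ x y, f' (φ y * (φ x)⁻¹) = f (y * x⁻¹)) (x y : G) :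
    convSq f' (φ y * (φ x)⁻¹) = convSq f (y * x⁻¹) := by
  unfold convSq
  rw [← Equiv.sum_comp (φ.trans (Equiv.mulRight (φ x)⁻¹)) fun z => f' z * f' (φ y * (φ x)⁻¹ * z⁻¹),
    ← Equiv.sum_comp (Equiv.mulRight x⁻¹) fun z => f z * f (y * x⁻¹ * z⁻¹)]
  refine Finset.sum_congr rfl fun z _ => ?_
  simp only [Equiv.trans_apply, Equiv.coe_mulRight, mul_inv_rev, inv_inv, mul_assoc,
    inv_mul_cancel_left]
  rw [h, h]

lemma iterate_convSq_apply_eq_of_equiv {f f' : G → ℕ} (φ : G ≃ G)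
    (h : ∀ x y, f' (φ y * (φ x)⁻¹) = f (y * x⁻¹)) (m : ℕ) (x y : G) :
    convSq^[m] f' (φ y * (φ x)⁻¹) = convSq^[m] f (y * x⁻¹) := by
  induction m generalizing x y with
  | zero => exact h x y
  | succ m ih =>
    simp only [Function.iterate_succ_apply']
    exact convSq_apply_eq_of_equiv φ ih x y

lemma sum_convSq (f : G → ℕ) : ∑ g, convSq f g = (∑ g, f g) ^ 2 := by
  unfold convSq
  rw [Finset.sum_comm, sq, Finset.sum_mul]
  refine Finset.sum_congr rfl fun h _ => ?_
  rw [← Finset.mul_sum, ← Equiv.sum_comp (Equiv.mulRight h⁻¹) f]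
  rfl

lemma sum_iterate_convSq (f : G → ℕ) (m : ℕ) :
    ∑ g, convSq^[m] f g = (∑ g, f g) ^ 2 ^ m := by
  induction m with
  | zero => simp
  | succ m ih => rw [Function.iterate_succ_apply', sum_convSq, ih, ← pow_mul, pow_succ]

end Convolution

section DihedralTransform

open DihedralGroup

variable {n : ℕ} [NeZero n] {R : Type*} [CommRing R]

lemma DihedralGroup.sum_eq {M : Type*} [AddCommMonoid M] (F : DihedralGroup n → M) :
    ∑ x, F x = ∑ i, F (r i) + ∑ i, F (sr i) := by
  rw [← Equiv.sum_comp equivSum.symm, Fintype.sum_sum_type]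
  rfl

lemma sum_sum_mul_sub_mul (ψ : AddChar (ZMod n) R) (u v : ZMod n → R) :
    ∑ k, (∑ i, u i * v (k - i)) * ψ k = (∑ i, u i * ψ i) * ∑ i, v i * ψ i := by
  simp only [Finset.sum_mul]
  rw [Finset.sum_comm]
  refine Finset.sum_congr rfl fun i _ => ?_
  rw [Finset.mul_sum, ← Equiv.sum_comp (Equiv.addRight i) fun k => u i * v (k - i) * ψ k]
  refine Finset.sum_congr rfl fun j _ => ?_
  simp only [Equiv.coe_addRight, add_sub_cancel_right, AddChar.map_add_eq_mul]
  ring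

lemma sum_sum_mul_sub_rev_mul (ψ : AddChar (ZMod n) R) (u v : ZMod n → R) :
    ∑ k, (∑ i, u i * v (i - k)) * ψ k = (∑ i, u i * ψ i) * ∑ i, v i * ψ⁻¹ i := by
  simp only [Finset.sum_mul]
  rw [Finset.sum_comm]
  refine Finset.sum_congr rfl fun i _ => ?_
  rw [Finset.mul_sum, ← Equiv.sum_comp (Equiv.subLeft i) fun k => u i * v (i - k) * ψ k]
  refine Finset.sum_congr rfl fun j _ => ?_
  rw [Equiv.subLeft_apply, sub_sub_cancel, sub_eq_add_neg, AddChar.map_add_eq_mul,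
    AddChar.inv_apply]
  ring

/-- The transform of the restriction of `f` to the rotations. -/
def rotSum (ψ : AddChar (ZMod n) R) (f : DihedralGroup n → ℕ) : R := ∑ i, (f (r i) : R) * ψ i

/-- The transform of the restriction of `f` to the reflections. -/
def refSum (ψ : AddChar (ZMod n) R) (f : DihedralGroup n → ℕ) : R := ∑ i, (f (sr i) : R) * ψ i

lemma rotSum_convSq (ψ : AddChar (ZMod n) R) (f : DihedralGroup n → ℕ) :
    rotSum ψ (convSq f) = rotSum ψ f ^ 2 + refSum ψ f * refSum ψ⁻¹ f := by
  simp only [rotSum, refSum, sq, ← sum_sum_mul_sub_mul, ← sum_sum_mul_sub_rev_mul,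
    ← Finset.sum_add_distrib, ← add_mul]
  simp [convSq, DihedralGroup.sum_eq, sub_eq_add_neg, Finset.sum_add_distrib]

lemma refSum_convSq (ψ : AddChar (ZMod n) R) (f : DihedralGroup n → ℕ) :
    refSum ψ (convSq f) = refSum ψ f * (rotSum ψ f + rotSum ψ⁻¹ f) := by
  rw [mul_add, mul_comm (refSum ψ f) (rotSum ψ f)]
  simp only [rotSum, refSum, ← sum_sum_mul_sub_mul, ← sum_sum_mul_sub_rev_mul,
    ← Finset.sum_add_distrib, ← add_mul]
  simp [convSq, DihedralGroup.sum_eq, sub_eq_add_neg, Finset.sum_add_distrib]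

end DihedralTransform

section Packing

lemma sum_mul_pow_succ_lt {X : ℕ} (c : ℕ → ℕ) (hc : ∀ i, c i + 1 < X) (k : ℕ) :
    ∑ i ∈ Finset.range (k + 1), c i * X ^ i + 1 < X ^ (k + 1) := by
  have h : ∀ k, ∑ i ∈ Finset.range k, c i * X ^ i + 1 ≤ X ^ k := by
    intro k
    induction k with
    | zero => simp
    | succ k ih =>
      rw [Finset.sum_range_succ, pow_succ]
      nlinarith [hc k, pow_pos (by have := hc 0; omega : 0 < X) k]
  rw [Finset.sum_range_succ, pow_succ]
  nlinarith [hc k, h k, pow_pos (by have := hc 0; omega : 0 < X) k]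

lemma sum_mul_pow_succ_mod {X : ℕ} (c : ℕ → ℕ) (hc : c 0 < X) (k : ℕ) :
    (∑ i ∈ Finset.range (k + 1), c i * X ^ i) % X = c 0 := by
  rw [Finset.sum_range_succ']
  simp only [pow_succ, ← mul_assoc, ← Finset.sum_mul, pow_zero, mul_one]
  rw [Nat.mul_add_mod_self_right, Nat.mod_eq_of_lt hc]

end Packing

section PackedConvolution

open DihedralGroup

/-- The rotation transform of the `m`-fold iterated convolution square, computed modulo `N` from
the transforms of a weight function at a character and its inverse. -/
def packedConvSq (N : ℕ) : ℕ → ℕ → ℕ → ℕ → ℕ → ℕ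
  | 0, a, _, _, _ => a
  | m + 1, a, a', b, b' => packedConvSq N m ((a ^ 2 + b * b') % N) ((a' ^ 2 + b * b') % N)
      (b * (a + a') % N) (b' * (a + a') % N)

lemma cast_packedConvSq {n N : ℕ} [NeZero n] (ψ : AddChar (ZMod n) (ZMod N)) (m : ℕ)
    {f : DihedralGroup n → ℕ} {a a' b b' : ℕ} (ha : (a : ZMod N) = rotSum ψ f)
    (ha' : (a' : ZMod N) = rotSum ψ⁻¹ f) (hb : (b : ZMod N) = refSum ψ f)
    (hb' : (b' : ZMod N) = refSum ψ⁻¹ f) :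
    (packedConvSq N m a a' b b' : ZMod N) = rotSum ψ (convSq^[m] f) := by
  induction m generalizing f a a' b b' with
  | zero => exact ha
  | succ m ih =>
    rw [packedConvSq, Function.iterate_succ_apply]
    apply ih <;> rw [ZMod.natCast_mod] <;> push_cast [ha, ha', hb, hb']
    · rw [rotSum_convSq]
    · rw [rotSum_convSq, inv_inv, mul_comm (refSum ψ f)]
    · rw [refSum_convSq]
    · rw [refSum_convSq, inv_inv, add_comm]

lemma packedConvSq_lt {N : ℕ} (hN : 0 < N) (m a a' b b' : ℕ) :
    packedConvSq N (m + 1) a a' b b' < N := by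
  induction m generalizing a a' b b' with
  | zero => exact Nat.mod_lt _ hN
  | succ m ih => exact ih ..

/-- The number with base `X` digits `g 0, …, g 8`. -/
def pack (X : ℕ) (g : ℕ → ℕ) : ℕ := ∑ i ∈ Finset.range 9, g i * X ^ i

lemma sum_mul_zmodChar {N X : ℕ} (h : (X : ZMod N) ^ 9 = 1) (g : ℕ → ℕ) :
    ∑ i : ZMod 9, (g i.val : ZMod N) * AddChar.zmodChar 9 h i = (pack X g : ℕ) := by
  rw [pack, Finset.sum_range, Nat.cast_sum]
  refine Finset.sum_congr rfl fun i _ => ?_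
  rw [AddChar.zmodChar_apply]
  push_cast
  rfl

lemma sum_mul_zmodChar_inv {N X : ℕ} (h : (X : ZMod N) ^ 9 = 1) (g : ℕ → ℕ) :
    ∑ i : ZMod 9, (g i.val : ZMod N) * (AddChar.zmodChar 9 h)⁻¹ i =
      (pack X fun i => g ((9 - i) % 9) : ℕ) := by
  rw [← sum_mul_zmodChar h, ← Equiv.sum_comp (Equiv.neg (ZMod 9))]
  refine Finset.sum_congr rfl fun i _ => ?_
  rw [Equiv.neg_apply, AddChar.inv_apply, neg_neg, ZMod.neg_val']

/-- The weight function on `D₁₈` with values `p i` on rotations and `q i` on reflections. -/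
def dihedralWeight (p q : ℕ → ℕ) : DihedralGroup 9 → ℕ
  | r i => p i.val
  | sr i => q i.val

lemma packedConvSq_mod {N X : ℕ} (hN : N + 1 = X ^ 9) {m : ℕ} {p q : ℕ → ℕ}
    (hX : (∑ x, dihedralWeight p q x) ^ 2 ^ (m + 1) + 1 < X) :
    packedConvSq N (m + 1) (pack X p) (pack X fun i => p ((9 - i) % 9)) (pack X q)
      (pack X fun i => q ((9 - i) % 9)) % X = convSq^[m + 1] (dihedralWeight p q) 1 := by
  have h : (X : ZMod N) ^ 9 = 1 := by
    rw [← Nat.cast_pow, ← hN]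
    simp
  have hNpos : 0 < N := by
    have : X ≤ X ^ 9 := Nat.le_self_pow (by norm_num) X
    omega
  set F := convSq^[m + 1] (dihedralWeight p q) with hF
  have hbound : ∀ x, F x + 1 < X := fun x => by
    have h1 := Finset.single_le_sum (f := F) (fun _ _ => Nat.zero_le _) (Finset.mem_univ x)
    have h2 := sum_iterate_convSq (dihedralWeight p q) (m + 1)
    rw [← hF] at h2
    omega
  have hcast := cast_packedConvSq (AddChar.zmodChar 9 h) (m + 1) (f := dihedralWeight p q)
    (sum_mul_zmodChar h p).symm (sum_mul_zmodChar_inv h p).symm (sum_mul_zmodChar h q).symm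
    (sum_mul_zmodChar_inv h q).symm
  have hpack : rotSum (AddChar.zmodChar 9 h) F =
      (pack X fun i => F (r (i : ZMod 9)) : ℕ) := by
    rw [← sum_mul_zmodChar h, rotSum]
    simp only [ZMod.natCast_zmod_val]
  rw [← hF, hpack, ZMod.natCast_eq_natCast_iff] at hcast
  have hlt := sum_mul_pow_succ_lt (fun i => F (r (i : ZMod 9))) (fun _ => hbound _) 8
  have heq := Nat.ModEq.eq_of_lt_of_lt hcast (packedConvSq_lt hNpos ..)
    (Nat.lt_of_add_lt_add_right (n := 1) (by rw [hN]; exact hlt))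
  rw [heq, pack, sum_mul_pow_succ_mod _ (by have := hbound (r ((0 : ℕ) : ZMod 9)); omega)]
  simp

end PackedConvolution

section ConnectionCodes

open DihedralGroup

/-- The bit recording whether a pair `{x, x⁻¹}` of nontrivial elements of `D₁₈` is present. -/
def bitIndex : DihedralGroup 9 → ℕ
  | r i => min (i.val - 1) (8 - i.val)
  | sr i => 4 + i.val

/-- The inverse-closed subset of `D₁₈` encoded by the bits of `c`. -/
def codeSet (c : ℕ) : Set (DihedralGroup 9) := {x | x ≠ 1 ∧ c.testBit (bitIndex x)}

lemma exists_codeSet_eq {S : Set (DihedralGroup 9)} (h1 : 1 ∉ S) (hS : S⁻¹ = S) :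
    ∃ c < 2 ^ 13, codeSet c = S := by
  classical
  have hlt : ∀ x, bitIndex x < 13 := by
    rintro (i | i) <;> revert i <;> decide
  have hinj : ∀ x y, x ≠ 1 → y ≠ 1 → bitIndex x = bitIndex y → x = y ∨ x = y⁻¹ := by
    rintro (i | i) (j | j) <;> revert i j <;> decide
  refine ⟨Nat.ofBits fun j : Fin 13 => decide (∃ x ∈ S, bitIndex x = j),
    Nat.ofBits_lt_two_pow _, ?_⟩
  ext x
  simp only [codeSet, Set.mem_ofPred_eq, Nat.testBit_ofBits_lt _ _ (hlt x), decide_eq_true_eq]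
  constructor
  · rintro ⟨hx, y, hy, hxy⟩
    have hy1 : y ≠ 1 := fun h => h1 (h ▸ hy)
    rcases hinj y x hy1 hx hxy with rfl | rfl
    · exact hy
    · rwa [← hS]
  · exact fun hx => ⟨fun h => h1 (h ▸ hx), x, hx, rfl⟩

/-- The number whose `j`-th bit is the bit of `c` at the `j`-th entry of the list. -/
def permuteBits (l : List ℕ) (c : ℕ) : ℕ := l.foldr (fun i v => Nat.bit (c.testBit i) v) 0

lemma testBit_permuteBits (l : List ℕ) (c : ℕ) {j : ℕ} (hj : j < l.length) :
    (permuteBits l c).testBit j = c.testBit l[j] := by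
  induction l generalizing j with
  | nil => simp at hj
  | cons i l ih =>
    cases j with
    | zero => simp [permuteBits]
    | succ j => simpa [permuteBits, Nat.testBit_bit_succ] using ih (by simpa using hj)

/-- The action on codes of the automorphism doubling exponents. -/
def doubleCode : ℕ → ℕ := permuteBits [3, 0, 2, 1, 4, 9, 5, 10, 6, 11, 7, 12, 8]

/-- The action on codes of the automorphism fixing rotations and shifting reflections. -/
def shiftCode (c : ℕ) : ℕ := (c >>> 4 % 2 ^ 8) <<< 5 ||| ((c >>> 12 % 2 ^ 1) <<< 4 ||| c % 2 ^ 4)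

lemma testBit_shiftCode (c : ℕ) {j : ℕ} (hj : j < 13) : (shiftCode c).testBit j =
    c.testBit [0, 1, 2, 3, 12, 4, 5, 6, 7, 8, 9, 10, 11][j] := by
  simp only [shiftCode, Nat.testBit_or, Nat.testBit_shiftLeft, Nat.testBit_shiftRight,
    Nat.testBit_mod_two_pow]
  interval_cases j <;> simp

/-- Two codes are equivalent if their sets are related by an automorphism. -/
def CodeEquiv (c d : ℕ) : Prop :=
  ∃ α : DihedralGroup 9 ≃* DihedralGroup 9, ∀ x, x ∈ codeSet c ↔ α x ∈ codeSet d

lemma CodeEquiv.trans {c d e : ℕ} (h : CodeEquiv c d) (h' : CodeEquiv d e) : CodeEquiv c e := by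
  obtain ⟨α, hα⟩ := h
  obtain ⟨β, hβ⟩ := h'
  exact ⟨α.trans β, fun x => (hα x).trans (hβ (α x))⟩

lemma CodeEquiv.iterate {t : ℕ → ℕ} (h : ∀ c, CodeEquiv c (t c)) (m c : ℕ) :
    CodeEquiv c (t^[m] c) := by
  induction m with
  | zero => exact ⟨MulEquiv.refl _, fun _ => Iff.rfl⟩
  | succ m ih => exact Function.iterate_succ_apply' t m c ▸ ih.trans (h _)

lemma codeEquiv_of_testBit_eq {c d : ℕ} {l : List ℕ} (α : DihedralGroup 9 ≃* DihedralGroup 9)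
    (hα : ∀ x, x ≠ 1 → l[bitIndex (α x)]? = some (bitIndex x))
    (hd : ∀ j (hj : j < l.length), d.testBit j = c.testBit l[j]) : CodeEquiv c d := by
  refine ⟨α, fun x => ?_⟩
  simp only [codeSet, Set.mem_ofPred_eq, ne_eq, EmbeddingLike.map_eq_one_iff]
  refine and_congr_right fun hx => ?_
  obtain ⟨hlt, heq⟩ := List.getElem?_eq_some_iff.1 (hα x hx)
  rw [hd _ hlt, heq]

lemma codeEquiv_doubleCode (c : ℕ) : CodeEquiv c (doubleCode c) := by
  refine codeEquiv_of_testBit_eq (affineAut (ZMod.unitOfCoprime 2 (by norm_num)) 0) ?_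
    fun j hj => testBit_permuteBits _ c hj
  rintro (i | i) <;> revert i <;> decide

lemma codeEquiv_shiftCode (c : ℕ) : CodeEquiv c (shiftCode c) := by
  refine codeEquiv_of_testBit_eq (affineAut 1 1) ?_ fun j hj => testBit_shiftCode c hj
  rintro (i | i) <;> revert i <;> decide

/-- The codes of the sets related by an automorphism to the set with code `c`. -/
def codeOrbit (c : ℕ) : List ℕ := (List.iterate doubleCode c 6).flatMap (List.iterate shiftCode · 9)

lemma codeEquiv_of_mem_codeOrbit {c d : ℕ} (h : d ∈ codeOrbit c) : CodeEquiv c d := by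
  simp only [codeOrbit, List.mem_flatMap, List.mem_iterate] at h
  obtain ⟨_, ⟨i, _, rfl⟩, j, _, rfl⟩ := h
  exact (CodeEquiv.iterate codeEquiv_doubleCode i c).trans
    (CodeEquiv.iterate codeEquiv_shiftCode j _)

/-- The number whose bits at the entries of the list are set. -/
def bitMask (l : List ℕ) : ℕ := l.foldr (fun c m => 1 <<< c ||| m) 0

lemma testBit_bitMask (l : List ℕ) (j : ℕ) : (bitMask l).testBit j ↔ j ∈ l := by
  induction l with
  | nil => simp [bitMask]
  | cons i l ih =>
    rw [List.mem_cons, ← ih, eq_comm (a := j)]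
    simp [bitMask, Nat.testBit_or, Nat.one_shiftLeft, Nat.testBit_two_pow]

lemma exists_mem_of_testBit_foldr_lor {l : List ℕ} {F : ℕ → ℕ} {j : ℕ}
    (h : (l.foldr (fun c m => F c ||| m) 0).testBit j) : ∃ c ∈ l, (F c).testBit j := by
  induction l with
  | nil => simp at h
  | cons i l ih =>
    rw [List.foldr_cons, Nat.testBit_or, Bool.or_eq_true] at h
    rcases h with h | h
    · exact ⟨i, List.mem_cons_self, h⟩
    · obtain ⟨c, hc, hj⟩ := ih h
      exact ⟨c, List.mem_cons_of_mem _ hc, hj⟩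

/-- The weights on rotations: `4` at the identity, and `0` or `1` elsewhere. -/
def rotationWeight (c : ℕ) : ℕ → ℕ
  | 0 => 4
  | i + 1 => (c.testBit (min i (7 - i))).toNat

/-- The weights on reflections. -/
def reflectionWeight (c i : ℕ) : ℕ := (c.testBit (4 + i)).toNat

/-- The number of closed walks of length `16` at a vertex in the Cayley graph of code `c` with four
loops added at every vertex. -/
def closedWalks (c : ℕ) : ℕ :=
  packedConvSq (2 ^ (100 * 9) - 1) 4 (pack (2 ^ 100) (rotationWeight c))
    (pack (2 ^ 100) fun i => rotationWeight c ((9 - i) % 9)) (pack (2 ^ 100) (reflectionWeight c))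
    (pack (2 ^ 100) fun i => reflectionWeight c ((9 - i) % 9)) % 2 ^ 100

/-- Representatives of the orbits of codes, ordered by their number of closed walks. -/
def codeReps : List ℕ :=
  [0, 16, 48, 1, 144, 4, 176, 112, 17, 1168, 20, 432, 368, 50, 145, 1200, 240, 52, 56, 49, 5, 3,
   148, 1169, 1264, 184, 752, 116, 1456, 21, 496, 120, 178, 114, 19, 177, 180, 113, 1172, 248,
   1520, 54, 434, 58, 60, 1008, 53, 1201, 376, 147, 3504, 372, 244, 149, 440, 370, 242, 433, 57,
   369, 51, 436, 241, 1204, 11, 7, 124, 118, 2032, 3568, 504, 1171, 1266, 1457, 185, 188, 122,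
   182, 760, 181, 756, 500, 1272, 117, 186, 754, 498, 121, 1265, 753, 179, 1268, 1173, 497, 115,
   27, 23, 1460, 4080, 252, 380, 3505, 1528, 442, 1012, 374, 246, 250, 249, 373, 1203, 1016,
   1522, 1010, 438, 444, 437, 377, 441, 245, 1521, 378, 1205, 155, 62, 59, 151, 61, 55, 1524,
   435, 1009, 371, 243, 3508, 15, 8176, 508, 764, 1274, 2034, 758, 502, 3569, 506, 1179, 126,
   189, 505, 187, 757, 125, 190, 1459, 123, 2036, 1270, 1276, 2040, 183, 1269, 761, 1175, 1273,
   2033, 501, 119, 762, 1461, 1267, 3572, 755, 499, 31, 1211, 1020, 254, 1014, 253, 3507, 443,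
   446, 381, 379, 4081, 382, 445, 1529, 1207, 1532, 1018, 1526, 439, 251, 1525, 4084, 1013, 375,
   1530, 1017, 247, 1523, 3509, 1011, 63, 159, 1467, 510, 509, 8177, 1275, 2038, 1278, 765,
   8180, 2042, 2044, 763, 766, 2037, 1277, 1463, 1271, 3571, 507, 3573, 759, 2041, 2035, 503,
   191, 127, 1183, 3515, 1022, 1533, 1531, 4085, 1021, 1534, 1019, 1527, 4083, 3511, 1015, 447,
   383, 1215, 255, 8181, 3579, 2046, 2043, 8179, 3575, 2045, 1279, 767, 1471, 511, 2039, 4091,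
   1535, 4087, 1023, 3519, 8187, 8183, 2047, 3583, 4095, 8191]

lemma bitMask_codeOrbit_codeReps :
    codeReps.foldr (fun c m => bitMask (codeOrbit c) ||| m) 0 = 2 ^ 2 ^ 13 - 1 := by
  decide +kernel

lemma isChain_closedWalks_codeReps : (codeReps.map closedWalks).IsChain (· < ·) := by
  decide +kernel

lemma exists_mem_codeReps_codeEquiv {c : ℕ} (hc : c < 2 ^ 13) : ∃ d ∈ codeReps, CodeEquiv d c := by
  obtain ⟨d, hd, hcd⟩ := exists_mem_of_testBit_foldr_lor
    (l := codeReps) (F := fun d => bitMask (codeOrbit d)) (j := c) (by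
      rw [bitMask_codeOrbit_codeReps, Nat.testBit_two_pow_sub_one, decide_eq_true hc])
  exact ⟨d, hd, codeEquiv_of_mem_codeOrbit ((testBit_bitMask _ _).1 hcd)⟩

lemma closedWalks_injOn {c d : ℕ} (hc : c ∈ codeReps) (hd : d ∈ codeReps)
    (h : closedWalks c = closedWalks d) : c = d := by
  have hlt := List.isChain_iff_pairwise.1 isChain_closedWalks_codeReps
  exact List.inj_on_of_nodup_map (hlt.imp fun h => h.ne) hc hd h

open Classical in
lemma dihedralWeight_eq_ite (c : ℕ) (x : DihedralGroup 9) :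
    dihedralWeight (rotationWeight c) (reflectionWeight c) x =
      if x = 1 then 4 else if x ∈ codeSet c then 1 else 0 := by
  have toNat_eq : ∀ b : Bool, b.toNat = if b then 1 else 0 := by decide
  by_cases hx : x = 1
  · subst hx
    rfl
  rw [if_neg hx]
  simp only [codeSet, Set.mem_ofPred_eq, hx, ne_eq, not_false_eq_true, true_and, ← toNat_eq]
  rcases x with (i | i)
  · cases hi : i.val with
    | zero => exact absurd (congrArg r ((ZMod.val_eq_zero i).1 hi)) hx
    | succ k =>
      have : 8 - (k + 1) = 7 - k := by omega
      simp only [dihedralWeight, rotationWeight, bitIndex, hi, Nat.add_sub_cancel, this]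
  · rfl

lemma dihedralWeight_eq_of_equiv {c d : ℕ} (φ : DihedralGroup 9 ≃ DihedralGroup 9)
    (h : ∀ x y, φ y * (φ x)⁻¹ ∈ codeSet d ↔ y * x⁻¹ ∈ codeSet c) (x y : DihedralGroup 9) :
    dihedralWeight (rotationWeight d) (reflectionWeight d) (φ y * (φ x)⁻¹) =
      dihedralWeight (rotationWeight c) (reflectionWeight c) (y * x⁻¹) := by
  classical
  rw [dihedralWeight_eq_ite, dihedralWeight_eq_ite]
  refine if_congr ?_ rfl (if_congr (h x y) rfl rfl)
  rw [mul_inv_eq_one, mul_inv_eq_one, φ.injective.eq_iff]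

set_option exponentiation.threshold 900 in
lemma closedWalks_eq (c : ℕ) : closedWalks c =
    convSq^[4] (dihedralWeight (rotationWeight c) (reflectionWeight c)) 1 := by
  have hX : 72 ^ 16 + 1 < 2 ^ 100 := by norm_num
  have hN : 2 ^ (100 * 9) - 1 + 1 = (2 ^ 100) ^ 9 := by
    rw [Nat.sub_add_cancel Nat.one_le_two_pow, pow_mul]
  rw [closedWalks]
  generalize 2 ^ (100 * 9) - 1 = N at hN ⊢
  generalize 2 ^ 100 = X at hN hX ⊢
  refine packedConvSq_mod hN (lt_of_le_of_lt (Nat.add_le_add_right ?_ 1) hX)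
  have h := Finset.sum_le_card_nsmul Finset.univ
    (dihedralWeight (rotationWeight c) (reflectionWeight c)) 4 fun x _ => by
      classical
      rw [dihedralWeight_eq_ite]
      split_ifs <;> norm_num
  rw [Finset.card_univ, DihedralGroup.card] at h
  exact Nat.pow_le_pow_left h _

lemma closedWalks_eq_of_equiv {c d : ℕ} (φ : DihedralGroup 9 ≃ DihedralGroup 9)
    (h : ∀ x y, φ y * (φ x)⁻¹ ∈ codeSet d ↔ y * x⁻¹ ∈ codeSet c) :
    closedWalks c = closedWalks d := by
  have := iterate_convSq_apply_eq_of_equiv φ (dihedralWeight_eq_of_equiv φ h) 4 1 1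
  simpa only [mul_inv_cancel, ← closedWalks_eq] using this.symm

lemma isCIGroup_dihedralGroup_nine : IsCIGroup (DihedralGroup 9) := by
  intro S hS1 hS T hT1 hT ⟨f⟩
  have hf := cay_iso_mem_iff hS1 hS hT1 hT f
  obtain ⟨c, hc, rfl⟩ := exists_codeSet_eq hS1 hS
  obtain ⟨d, hd, rfl⟩ := exists_codeSet_eq hT1 hT
  obtain ⟨c', hc', α, hα⟩ := exists_mem_codeReps_codeEquiv hc
  obtain ⟨d', hd', β, hβ⟩ := exists_mem_codeReps_codeEquiv hd
  have hcd : c' = d' := by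
    refine closedWalks_injOn hc' hd' (closedWalks_eq_of_equiv
      ((α.toEquiv.trans f.toEquiv).trans β.symm.toEquiv) fun x y => ?_)
    have h := hf (α x) (α y)
    simp [hα, hβ, ← h]
  subst hcd
  refine ⟨α.symm.trans β, image_eq_of_forall_mem_iff _ fun x => ?_⟩
  simp [← hβ, hα]

end ConnectionCodes


/-- `D_{2p^k}` is a CI-group iff `p ≥ 5` and `k = 1`, or `(p,k) ∈ {(2,1),(3,1),(3,2)}`. -/
theorem dihedral_prime_power_CIGroup_iff (p k : ℕ) (hp : p.Prime) (hk : 1 ≤ k) :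
    IsCIGroup (DihedralGroup (p ^ k)) ↔
      (5 ≤ p ∧ k = 1) ∨ (p = 2 ∧ k = 1) ∨ (p = 3 ∧ k = 1) ∨ (p = 3 ∧ k = 2) := by
  constructor
  · intro h
    obtain ⟨j, rfl⟩ := Nat.exists_eq_add_of_le' hk
    by_cases h2 : p = 2
    · subst h2
      rcases j with _ | j
      · exact .inr (.inl ⟨rfl, rfl⟩)
      · exact absurd (pow_succ' 2 (j + 1) ▸ h)
          (not_isCIGroup_dihedralGroup_of_even (Nat.le_self_pow j.succ_ne_zero 2))
    rcases j with _ | j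
    · have := hp.two_le
      have : p ≠ 4 := by rintro rfl; norm_num at hp
      omega
    · by_cases h3 : p = 3 ∧ j = 0
      · exact .inr (.inr (.inr ⟨h3.1, by rw [h3.2]⟩))
      · exact absurd h (not_isCIGroup_dihedralGroup_odd_prime_pow hp h2 h3)
  · rintro (⟨h5, rfl⟩ | ⟨rfl, rfl⟩ | ⟨rfl, rfl⟩ | ⟨rfl, rfl⟩)
    · rw [pow_one]
      exact isCIGroup_dihedralGroup_odd_prime hp (by omega)
    · rw [pow_one]
      exact isCIGroup_of_isKleinFour _
    · rw [pow_one]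
      exact isCIGroup_dihedralGroup_odd_prime hp (by norm_num)
    · exact isCIGroup_dihedralGroup_nine
end

section
/- Let G be a finite group and S ⊆ G. The bi-Cayley graph BCay(G,S) is a BCI-graph if and only if BCay(G, G∖S) is a BCI-graph. -/
open SimpleGraph

namespace BCay

variable {G : Type*} [Group G] {S T : Set G}

lemma adj_iff {u v : G × Fin 2} : (BCay G S).Adj u v ↔
    (u.2 = 0 ∧ v.2 = 1 ∧ v.1 * u.1⁻¹ ∈ S) ∨ (v.2 = 0 ∧ u.2 = 1 ∧ u.1 * v.1⁻¹ ∈ S) := by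
  simp only [BCay, SimpleGraph.fromRel_adj, and_iff_right_iff_imp]
  rintro (⟨h, h', -⟩ | ⟨h, h', -⟩) rfl <;> simp [h] at h'

lemma snd_ne_of_adj {u v : G × Fin 2} (h : (BCay G S).Adj u v) : u.2 ≠ v.2 := by
  rcases adj_iff.1 h with ⟨h, h', -⟩ | ⟨h, h', -⟩ <;> simp [h, h']

lemma compl_adj_iff {u v : G × Fin 2} :
    (BCay G Sᶜ).Adj u v ↔ u.2 ≠ v.2 ∧ ¬ (BCay G S).Adj u v := by
  obtain ⟨a, i⟩ := u
  obtain ⟨b, j⟩ := v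
  fin_cases i <;> fin_cases j <;> simp [adj_iff]

/-- Right multiplication by a group element is an automorphism of a bi-Cayley graph. -/
def rightMul (S : Set G) (g : G) : BCay G S ≃g BCay G S where
  toEquiv := (Equiv.mulRight g).prodCongr (Equiv.refl _)
  map_rel_iff' := by simp [adj_iff]

@[simp] lemma rightMul_apply (g : G) (v : G × Fin 2) : rightMul S g v = (v.1 * g, v.2) := rfl

/-- When `S` is nonempty, every connected component meets both parts. -/
lemma exists_reachable_snd_eq (hS : S.Nonempty) (v : G × Fin 2) (i : Fin 2) :
    ∃ a, (BCay G S).Reachable v (a, i) := by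
  obtain ⟨s, hs⟩ := hS
  obtain ⟨b, j⟩ := v
  by_cases hij : j = i
  · exact ⟨b, hij ▸ Reachable.refl _⟩
  · fin_cases i <;> fin_cases j <;> simp at hij
    · exact ⟨s⁻¹ * b, Adj.reachable (adj_iff.2 (by simpa))⟩
    · exact ⟨s * b, Adj.reachable (adj_iff.2 (by simpa))⟩

/-- An isomorphism of bi-Cayley graphs preserves or exchanges the parts on each component. -/
lemma snd_add_snd_eq_of_reachable (φ : BCay G S ≃g BCay G T) {u v : G × Fin 2}
    (h : (BCay G S).Reachable u v) : (φ u).2 + u.2 = (φ v).2 + v.2 := by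
  obtain ⟨p⟩ := h
  induction p with
  | nil => rfl
  | cons h p ih =>
    rw [← ih]
    have key : ∀ a b c d : Fin 2, a ≠ b → c ≠ d → a + c = b + d := by decide
    exact key _ _ _ _ (snd_ne_of_adj (φ.map_adj_iff.2 h)) (snd_ne_of_adj h)

/-- Up to right multiplications, an isomorphism acts on the parts of any component as it does
on the component of the identity. -/
lemma exists_iso_snd_eq (hS : S.Nonempty) (hT : T.Nonempty) (φ : BCay G S ≃g BCay G T)
    (c : (BCay G S).ConnectedComponent) :
    ∃ f : BCay G S ≃g BCay G T, ∀ v, (BCay G S).connectedComponentMk v = c →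
      (BCay G T).Reachable (φ v) (f v) ∧ (f v).2 = (φ (1, 0)).2 + v.2 := by
  induction c using ConnectedComponent.ind with | _ w
  obtain ⟨a, ha⟩ := exists_reachable_snd_eq hS w 0
  obtain ⟨b, hb⟩ := exists_reachable_snd_eq hT (φ w) (φ (1, 0)).2
  let f : BCay G S ≃g BCay G T :=
    ((rightMul S a⁻¹).trans φ).trans (rightMul T ((φ (1, 0)).1⁻¹ * b))
  have hf : f (a, 0) = (b, (φ (1, 0)).2) := by simp [f]
  refine ⟨f, fun v hv ↦ ?_⟩
  have hvw : (BCay G S).Reachable v w := ConnectedComponent.exact hv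
  have hva := hvw.trans ha
  constructor
  · have h₁ : (BCay G T).Reachable (φ v) (φ w) := φ.reachable_iff.2 hvw
    have h₂ : (BCay G T).Reachable (f v) (f (a, 0)) := f.reachable_iff.2 hva
    rw [hf] at h₂
    exact (h₁.trans hb).trans h₂.symm
  · have h := snd_add_snd_eq_of_reachable f hva
    rw [hf] at h
    have key : ∀ x y z : Fin 2, x + y = z + 0 → x = z + y := by decide
    exact key _ _ _ h

/-- Isomorphic bi-Cayley graphs of a finite group admit an isomorphism which globally preserves
or exchanges the two parts. -/
lemma exists_iso_snd_eq_add [Finite G] (hS : S.Nonempty) (hT : T.Nonempty)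
    (φ : BCay G S ≃g BCay G T) :
    ∃ (f : BCay G S ≃g BCay G T) (i : Fin 2), ∀ v, (f v).2 = i + v.2 := by
  choose f hf using exists_iso_snd_eq hS hT φ
  let F : G × Fin 2 → G × Fin 2 := fun v ↦ f ((BCay G S).connectedComponentMk v) v
  have hφF (v) : (BCay G T).Reachable (φ v) (F v) := (hf _ v rfl).1
  have hcomp {v w} (h : (BCay G T).Reachable (F v) (F w)) :
      (BCay G S).connectedComponentMk v = (BCay G S).connectedComponentMk w :=
    ConnectedComponent.sound
      (φ.reachable_iff.1 (((hφF v).trans h).trans (hφF w).symm))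
  have hinj : F.Injective := by
    intro v w h
    have hc := hcomp (v := v) (w := w) (h ▸ Reachable.refl (F v))
    simp only [F, hc] at h
    exact (f _).injective h
  have hadj {v w} : (BCay G T).Adj (F v) (F w) ↔ (BCay G S).Adj v w := by
    have key (hc : (BCay G S).connectedComponentMk v = (BCay G S).connectedComponentMk w) :
        (BCay G T).Adj (F v) (F w) ↔ (BCay G S).Adj v w := by
      simp only [F, hc]
      exact (f _).map_adj_iff
    exact ⟨fun h ↦ (key (hcomp h.reachable)).1 h,
      fun h ↦ (key (ConnectedComponent.sound h.reachable)).2 h⟩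
  exact ⟨⟨Equiv.ofBijective F (Finite.injective_iff_bijective.1 hinj), hadj⟩, (φ (1, 0)).2,
    fun v ↦ (hf _ v rfl).2⟩

lemma exists_adj_iff : (∃ u v, (BCay G S).Adj u v) ↔ S.Nonempty := by
  constructor
  · rintro ⟨u, v, h⟩
    rcases adj_iff.1 h with ⟨-, -, h⟩ | ⟨-, -, h⟩ <;> exact ⟨_, h⟩
  · rintro ⟨s, hs⟩
    exact ⟨(1, 0), (s, 1), adj_iff.2 (by simpa)⟩

lemma nonempty_of_iso (φ : BCay G S ≃g BCay G T) (hS : S.Nonempty) : T.Nonempty := by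
  obtain ⟨u, v, h⟩ := exists_adj_iff.2 hS
  exact exists_adj_iff.1 ⟨φ u, φ v, φ.map_adj_iff.2 h⟩

lemma nonempty_iso_compl [Finite G] (h : Nonempty (BCay G S ≃g BCay G T)) :
    Nonempty (BCay G Sᶜ ≃g BCay G Tᶜ) := by
  obtain ⟨φ⟩ := h
  rcases S.eq_empty_or_nonempty with rfl | hS
  · rcases T.eq_empty_or_nonempty with rfl | hT
    · exact ⟨Iso.refl⟩
    · exact absurd (nonempty_of_iso φ.symm hT) Set.not_nonempty_empty
  · obtain ⟨f, i, hf⟩ := exists_iso_snd_eq_add hS (nonempty_of_iso φ hS) φ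
    refine ⟨⟨f.toEquiv, fun {u v} ↦ ?_⟩⟩
    change (BCay G Tᶜ).Adj (f u) (f v) ↔ _
    rw [compl_adj_iff, compl_adj_iff, f.map_adj_iff, hf, hf, ne_eq, add_right_inj]

end BCay

lemma IsBCIGraph.compl {G : Type*} [Group G] [Finite G] {S : Set G} (h : IsBCIGraph G S) :
    IsBCIGraph G Sᶜ := by
  intro T hT
  obtain ⟨g, α, hgα⟩ := h Tᶜ (by simpa using BCay.nonempty_iso_compl hT)
  refine ⟨g, α, ?_⟩
  have hbij : Function.Bijective fun s ↦ g * α s := (Group.mulLeft_bijective g).comp α.bijective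
  rw [Set.image_compl_eq hbij, ← hgα, compl_compl]

/-- `BCay(G,S)` is a BCI-graph iff `BCay(G, G ∖ S)` is a BCI-graph. -/
theorem BCIGraph_compl_iff (G : Type*) [Group G] [Finite G] (S : Set G) :
    IsBCIGraph G S ↔ IsBCIGraph G Sᶜ := by
  exact ⟨IsBCIGraph.compl, fun h ↦ by simpa using h.compl⟩
end

section
/- Let G be a finite group, S ⊆ G, p a prime with |S| < p, and suppose Γ = BCay(G,S) is connected. Then for every vertex v of Γ, p does not divide the order of the stabilizer of v in the automorphism group Aut(Γ). -/
open SimpleGraph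

/-- A fixed point of a map of prime period `p` is forced inside any invariant set
with fewer than `p` elements. -/
theorem isFixedPt_of_iterate_mem_of_ncard_lt {V : Type*} {p : ℕ} (hp : p.Prime) {f : V → V}
    {w : V} (hf : Function.IsPeriodicPt f p w) {N : Set V} (hN : N.Finite)
    (hcard : N.ncard < p) (hmem : ∀ n, f^[n] w ∈ N) : Function.IsFixedPt f w := by
  rcases (Nat.dvd_prime hp).1 hf.minimalPeriod_dvd with h | h
  · exact Function.minimalPeriod_eq_one_iff_isFixedPt.1 h
  · have hinj := Function.iterate_injOn_Iio_minimalPeriod (f := f) (x := w)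
    rw [h] at hinj
    have hle := Set.ncard_le_ncard_of_injOn (fun n => f^[n] w) (fun n _ => hmem n) hinj hN
    rw [← Finset.coe_Iio, Set.ncard_coe_finset, Nat.card_Iio] at hle
    omega

/-- In a connected finite graph all of whose degrees are less than a prime `p`, the only
automorphism of order dividing `p` that fixes a vertex is the identity. -/
theorem SimpleGraph.Connected.eq_one_of_pow_prime_eq_one {V : Type*} [Finite V]
    {Γ : SimpleGraph V} (hΓ : Γ.Connected) {p : ℕ} (hp : p.Prime)
    (hdeg : ∀ u, (Γ.neighborSet u).ncard < p) {σ : Γ ≃g Γ} (hσ : σ ^ p = 1) {v : V}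
    (hv : σ v = v) : σ = 1 := by
  have hiter : ∀ (n : ℕ) (w : V), σ^[n] w = (σ ^ n) w := by
    intro n w
    induction n with
    | zero => rfl
    | succ n ih => rw [Function.iterate_succ_apply', ih, pow_succ']; rfl
  have hstep : ∀ u w, Γ.Adj u w → σ u = u → σ w = w := by
    intro u w huw hu
    refine isFixedPt_of_iterate_mem_of_ncard_lt hp (f := σ) ?_
      (Set.toFinite (Γ.neighborSet u)) (hdeg u) ?_
    · change σ^[p] w = w
      rw [hiter, hσ]; rfl
    · intro n
      induction n with
      | zero => exact huw
      | succ n ih =>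
        rw [Function.iterate_succ_apply', SimpleGraph.mem_neighborSet, ← hu]
        exact σ.map_rel_iff.2 ih
  have hwalk : ∀ {u w : V}, Γ.Walk u w → σ u = u → σ w = w := by
    intro u w q
    induction q with
    | nil => exact id
    | cons h _ ih => exact fun hu => ih (hstep _ _ h hu)
  ext w
  exact hwalk (hΓ.preconnected v w).some hv

/-- In a connected finite graph all of whose degrees are less than a prime `p`, no vertex
stabilizer in the automorphism group has order divisible by `p`. -/
theorem SimpleGraph.Connected.prime_not_dvd_card_stabilizer {V : Type*} [Finite V]
    {Γ : SimpleGraph V} (hΓ : Γ.Connected) {p : ℕ} (hp : p.Prime)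
    (hdeg : ∀ u, (Γ.neighborSet u).ncard < p) (v : V) :
    ¬ p ∣ Nat.card {σ : Γ ≃g Γ // σ v = v} := by
  intro hdvd
  have : Fact p.Prime := ⟨hp⟩
  have : Finite (Γ ≃g Γ) := Finite.of_injective (fun σ => (σ : V → V)) DFunLike.coe_injective
  let H : Subgroup (Γ ≃g Γ) :=
    { carrier := {σ | σ v = v}
      mul_mem' := fun {a b} ha hb => (congrArg a hb).trans ha
      one_mem' := rfl
      inv_mem' := fun {a} ha => a.symm_apply_eq.2 (Eq.symm ha) }
  obtain ⟨σ, hσ⟩ := exists_prime_orderOf_dvd_card' (G := H) p hdvd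
  have hpow : (σ : Γ ≃g Γ) ^ p = 1 := by
    rw [← Subgroup.orderOf_coe] at hσ
    rw [← hσ, pow_orderOf_eq_one]
  have hone : σ = 1 := Subtype.ext (hΓ.eq_one_of_pow_prime_eq_one hp hdeg hpow σ.2)
  rw [hone, orderOf_one] at hσ
  exact hp.one_lt.ne hσ

/-- Every vertex of `BCay(G,S)` has at most `|S|` neighbours. -/
theorem ncard_neighborSet_BCay_le (G : Type*) [Group G] [Finite G] (S : Set G) (u : G × Fin 2) :
    ((BCay G S).neighborSet u).ncard ≤ S.ncard := by
  obtain ⟨g, i⟩ := u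
  fin_cases i
  · refine Set.ncard_le_ncard_of_injOn (fun w => w.1 * g⁻¹) ?_ ?_ S.toFinite
    · rintro ⟨x, j⟩ hw
      simp_all [BCay]
    · rintro ⟨x, j⟩ hx ⟨y, k⟩ hy hxy
      simp_all [BCay]
  · refine Set.ncard_le_ncard_of_injOn (fun w => g * w.1⁻¹) ?_ ?_ S.toFinite
    · rintro ⟨x, j⟩ hw
      simp_all [BCay]
    · rintro ⟨x, j⟩ hx ⟨y, k⟩ hy hxy
      simp_all [BCay]

/-- If `BCay(G,S)` is connected and `|S| < p` for a prime `p`, then `p` does not divide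
the order of any vertex stabilizer in `Aut(BCay(G,S))`. -/
theorem prime_not_dvd_stabilizer (G : Type*) [Group G] [Finite G] (S : Set G)
    (p : ℕ) (hp : p.Prime) (hS : S.ncard < p) (hconn : (BCay G S).Connected)
    (v : G × Fin 2) :
    ¬ p ∣ Nat.card {σ : BCay G S ≃g BCay G S // σ v = v} := by
  exact hconn.prime_not_dvd_card_stabilizer hp
    (fun u => (ncard_neighborSet_BCay_le G S u).trans_lt hS) v
end
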